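/- arXiv:2510.07250 — 3 statements merged into one kernel-verified Lean document; each statement's English description precedes it below -/
import Mathlib

section
/- Consider the Gaussian link target with link f satisfying Assumption 3 with constants (C_f, C̃_f), a parameter set Θ ⊆ ℝ with sup_{θ∈Θ} θ² < ∞, and the quantities S*_N, p, q built from the truncated signed kernel with σ = 1. There exists a universal constant C > 0 such that whenever 2N+1 ≥ C̄_f and τ² ≥ C·max( (max(C̃_f,1))⁴·(max(L_f(2N), L̃_f(2N,τ), 1))²·N², sup_{θ∈Θ} θ² ): (a) for every θ ∈ Θ, (1/2)·∫_ℝ |∫_ℝ S*_N(y|x)·u(x;θ) dx − v(y;θ)| dy ≤ C̄_f·exp(−(2e)^{−1}·(2N+1)^{1/(2(1+C_f))}); and (b) for every θ ∈ Θ, (1/2)·∫_ℝ (|p(x) − 1| + q(x))·u(x;θ) dx ≤ 12·e^{−τ/8} + 15·sup_{θ'∈Θ} exp(θ'²/2 − τ²/8). -/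
open MeasureTheory Real Filter

/-- The Gaussian source density `u(x;θ)` with standard deviation `σ`. -/
noncomputable def srcDensity (σ θ x : ℝ) : ℝ :=
  (1 / (Real.sqrt (2 * Real.pi) * σ)) * Real.exp (-(x - θ)^2 / (2 * σ^2))

/-- The Gaussian link target density `v(y;θ) = (1/√(2π))·exp(−(y − f(θ/τ))²/2)`. -/
noncomputable def linkDensity (f : ℝ → ℝ) (τ y θ : ℝ) : ℝ :=
  (1 / Real.sqrt (2 * Real.pi)) * Real.exp (-(y - f (θ/τ))^2 / 2)

/-- The weighted derivative sum `Σ_{j=1}^{n} |f^{(j)}(t)|/(C̃^j·j!)`. -/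
noncomputable def derivSumF (f : ℝ → ℝ) (Ct : ℝ) (n : ℕ) (t : ℝ) : ℝ :=
  ∑ j ∈ Finset.Icc 1 n, |iteratedDeriv j f t| / (Ct^j * (Nat.factorial j : ℝ))

/-- Assumption 3 on the link function `f` with constants `(Cf, C̃f)`. -/
structure Assumption3 (f : ℝ → ℝ) (Cf : ℕ) (Ct : ℝ) : Prop where
  Ct_pos : 0 < Ct
  smooth : ContDiff ℝ (⊤ : ℕ∞) f
  bound_int : ∀ (θ : ℝ) (n : ℕ), 1 ≤ n → ∀ τ : ℝ, 2 * Real.sqrt 2 * max 1 |θ| ≤ τ →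
    Integrable (fun x : ℝ =>
      (derivSumF f Ct n ((θ + Real.sqrt 2 * x)/τ))^n *
        (Real.exp (-x^2/2) / Real.sqrt (2 * Real.pi)))
  bound_le : ∀ (θ : ℝ) (n : ℕ), 1 ≤ n → ∀ τ : ℝ, 2 * Real.sqrt 2 * max 1 |θ| ≤ τ →
    ∫ x : ℝ,
      (derivSumF f Ct n ((θ + Real.sqrt 2 * x)/τ))^n *
        (Real.exp (-x^2/2) / Real.sqrt (2 * Real.pi))
      ≤ (Nat.factorial (Cf * n) : ℝ)

/-- `C̄f = 32π²·(2e)^{4(1+Cf)}·e^{4(1+Cf)²}`. -/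
noncomputable def CbarF (Cf : ℕ) : ℝ :=
  32 * Real.pi^2 * (2 * Real.exp 1)^(4*(1+Cf)) * (Real.exp 1)^(4*(1+Cf)^2)

/-- `L_f(n) = sup_{|x|≤1} Σ_{j=1}^{n} |f^{(j)}(x)|/(C̃f^j·j!)`. -/
noncomputable def Lf (f : ℝ → ℝ) (Ct : ℝ) (n : ℕ) : ℝ :=
  ⨆ x ∈ {x : ℝ | |x| ≤ 1}, derivSumF f Ct n x

/-- `L̃_f(n,τ) = sup_{|x|≥1} (Σ_{j=1}^{n} |f^{(j)}(x)|/(C̃f^j·j!))·exp(−τ²x²/(8n))`. -/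
noncomputable def Ltf (f : ℝ → ℝ) (Ct : ℝ) (n : ℕ) (τ : ℝ) : ℝ :=
  ⨆ x ∈ {x : ℝ | 1 ≤ |x|},
    derivSumF f Ct n x * Real.exp (-(τ^2 * x^2) / (8*(n:ℝ)))

/-- The truncated signed kernel `S*_N(y|x)` (with `σ = 1`). -/
noncomputable def signedKernel (σ : ℝ) (v : ℝ → ℝ → ℝ) (N : ℕ) (y x : ℝ) : ℝ :=
  ∑ k ∈ Finset.range (N + 1),
    ((-1 : ℝ)^k * σ^(2*k) / ((2:ℝ)^k * (Nat.factorial k : ℝ))) *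
      iteratedDeriv (2*k) (fun θ => v y θ) x

/-- `p(x) = ∫ max(S*_N(y|x), 0) dy`. -/
noncomputable def pFun (σ : ℝ) (v : ℝ → ℝ → ℝ) (N : ℕ) (x : ℝ) : ℝ :=
  ∫ y : ℝ, max (signedKernel σ v N y x) 0

/-- `q(x) = −∫ min(S*_N(y|x), 0) dy`. -/
noncomputable def qFun (σ : ℝ) (v : ℝ → ℝ → ℝ) (N : ℕ) (x : ℝ) : ℝ :=
  - ∫ y : ℝ, min (signedKernel σ v N y x) 0

/-- The Markov kernel `T*_N(y|x) = max(S*_N(y|x), 0)/p(x)`. -/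
noncomputable def markovKernel (σ : ℝ) (v : ℝ → ℝ → ℝ) (N : ℕ) (y x : ℝ) : ℝ :=
  max (signedKernel σ v N y x) 0 / pFun σ v N x

open scoped ENNReal Topology

/-- The standard Gaussian density. -/
noncomputable def gaussDens (z : ℝ) : ℝ := (1 / √(2 * π)) * exp (-z ^ 2 / 2)

/-- The `k`-th probabilists' Hermite polynomial as a real function. -/
noncomputable def hermiteEval (k : ℕ) (z : ℝ) : ℝ := Polynomial.aeval z (Polynomial.hermite k)

/-- The Hermite function `He_k(z) φ(z)`, which is `(-1)^k φ^{(k)}(z)`. -/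
noncomputable def hermiteFun (k : ℕ) (z : ℝ) : ℝ := hermiteEval k z * gaussDens z

theorem gaussDens_pos (z : ℝ) : 0 < gaussDens z := by unfold gaussDens; positivity

theorem contDiff_gaussDens {n : WithTop ℕ∞} : ContDiff ℝ n gaussDens := by
  unfold gaussDens; fun_prop

theorem continuous_gaussDens : Continuous gaussDens := contDiff_gaussDens.continuous (n := 0)

theorem contDiff_hermiteEval {n : WithTop ℕ∞} (k : ℕ) : ContDiff ℝ n (hermiteEval k) := by
  unfold hermiteEval; exact Polynomial.contDiff_aeval _ _

theorem contDiff_hermiteFun {n : WithTop ℕ∞} (k : ℕ) : ContDiff ℝ n (hermiteFun k) :=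
  (contDiff_hermiteEval k).mul contDiff_gaussDens

theorem continuous_hermiteFun (k : ℕ) : Continuous (hermiteFun k) :=
  (contDiff_hermiteFun k).continuous (n := 0)

theorem hermiteFun_zero (z : ℝ) : hermiteFun 0 z = gaussDens z := by
  simp [hermiteFun, hermiteEval]

theorem hasDerivAt_gaussDens (z : ℝ) : HasDerivAt gaussDens (-(z * gaussDens z)) z := by
  have h : HasDerivAt (fun z : ℝ => -z ^ 2 / 2) (-z) z := by
    have := ((hasDerivAt_id z).pow 2).neg.div_const 2
    refine (this.congr_deriv ?_)
    simp; ring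
  have := (h.exp).const_mul (1 / √(2 * π))
  refine this.congr_deriv ?_
  unfold gaussDens; ring

theorem derivative_hermite_succ (k : ℕ) :
    Polynomial.derivative (Polynomial.hermite (k + 1)) = (k + 1 : ℕ) * Polynomial.hermite k := by
  induction k with
  | zero => simp
  | succ k ih =>
    rw [Polynomial.hermite_succ (k + 1), Polynomial.derivative_sub, Polynomial.derivative_mul, ih]
    rw [Polynomial.derivative_mul, Polynomial.hermite_succ k]
    simp
    ring

theorem hermiteEval_succ (k : ℕ) (z : ℝ) : hermiteEval (k + 1) z =
    z * hermiteEval k z - Polynomial.aeval z (Polynomial.derivative (Polynomial.hermite k)) := by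
  simp [hermiteEval, Polynomial.hermite_succ]

theorem hermiteEval_add_two (k : ℕ) (z : ℝ) : hermiteEval (k + 2) z =
    z * hermiteEval (k + 1) z - (k + 1) * hermiteEval k z := by
  rw [hermiteEval_succ, derivative_hermite_succ]
  simp [hermiteEval]

theorem hasDerivAt_hermiteFun (k : ℕ) (z : ℝ) :
    HasDerivAt (hermiteFun k) (-hermiteFun (k + 1) z) z := by
  have h : HasDerivAt (hermiteEval k)
      (Polynomial.aeval z (Polynomial.derivative (Polynomial.hermite k))) z :=
    Polynomial.hasDerivAt_aeval _ _
  refine (h.mul (hasDerivAt_gaussDens z)).congr_deriv ?_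
  unfold hermiteFun
  rw [hermiteEval_succ]; ring

theorem abs_hermiteEval_le (k : ℕ) (z : ℝ) : |hermiteEval k z| ≤ (|z| + k) ^ k := by
  induction k using Nat.twoStepInduction with
  | zero => simp [hermiteEval]
  | one => simp [hermiteEval]
  | more k ih1 ih2 =>
    rw [hermiteEval_add_two]
    have hz := abs_nonneg z
    have hk : (0 : ℝ) ≤ k := Nat.cast_nonneg k
    have h1 : |z * hermiteEval (k + 1) z - (k + 1) * hermiteEval k z| ≤
        |z| * (|z| + (k + 2)) ^ (k + 1) + (k + 1) * (|z| + (k + 2)) ^ k := by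
      refine (abs_sub _ _).trans ?_
      rw [abs_mul, abs_mul, abs_of_nonneg (by positivity : (0 : ℝ) ≤ k + 1)]
      gcongr
      · refine ih2.trans ?_
        push_cast
        gcongr
        linarith
      · refine ih1.trans ?_
        gcongr
        linarith
    refine h1.trans ?_
    push_cast
    have : (k + 1) * (|z| + (k + 2)) ^ k ≤ (k + 2) * (|z| + ((k : ℝ) + 2)) ^ (k + 1) := by
      rw [pow_succ]
      have : (0 : ℝ) ≤ (|z| + ((k : ℝ) + 2)) ^ k := by positivity
      have h3 : (1 : ℝ) ≤ |z| + (k + 2) := by linarith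
      nlinarith [mul_nonneg this (by linarith : (0 : ℝ) ≤ |z| + (k + 2) - 1),
        mul_nonneg hk (mul_nonneg this (by linarith : (0 : ℝ) ≤ |z| + (k + 2) - 1))]
    rw [pow_succ _ (k + 1)]
    linarith

theorem abs_hermiteEval_le_of_abs_le {b z : ℝ} (hz : |z| ≤ b) (k : ℕ) (hk : k ≤ b ^ 2) :
    |hermiteEval k z| ≤ (2 * b) ^ k := by
  have hb : 0 ≤ b := (abs_nonneg z).trans hz
  induction k using Nat.twoStepInduction with
  | zero => simp [hermiteEval]
  | one => simp [hermiteEval]; linarith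
  | more k ih1 ih2 =>
    push_cast at hk ih2
    specialize ih1 (by linarith)
    specialize ih2 (by linarith)
    rw [hermiteEval_add_two]
    refine (abs_sub _ _).trans ?_
    rw [abs_mul, abs_mul, abs_of_nonneg (by positivity : (0 : ℝ) ≤ k + 1)]
    calc |z| * |hermiteEval (k + 1) z| + (k + 1) * |hermiteEval k z|
        ≤ b * (2 * b) ^ (k + 1) + b ^ 2 * (2 * b) ^ k := by
          gcongr; linarith
      _ ≤ (2 * b) ^ (k + 2) := by
          have : 0 ≤ b ^ 2 * (2 * b) ^ k := by positivity
          rw [pow_succ, pow_add]; nlinarith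

/-- The integrable envelope `e^{|z|} φ(z)` of the Hermite functions. -/
noncomputable def gaussEnv (z : ℝ) : ℝ := exp |z| * gaussDens z

theorem gaussEnv_nonneg (z : ℝ) : 0 ≤ gaussEnv z :=
  mul_nonneg (exp_pos _).le (gaussDens_pos z).le

theorem continuous_gaussEnv : Continuous gaussEnv := by
  unfold gaussEnv
  exact (by fun_prop : Continuous fun z : ℝ => exp |z|).mul continuous_gaussDens

theorem abs_hermiteFun_le {n k : ℕ} (hk : k ≤ n) (z : ℝ) :
    |hermiteFun k z| ≤ (n : ℝ) ^ k * gaussEnv z := by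
  rw [hermiteFun, abs_mul, abs_of_pos (gaussDens_pos z), gaussEnv, ← mul_assoc]
  refine mul_le_mul_of_nonneg_right ?_ (gaussDens_pos z).le
  refine (abs_hermiteEval_le k z).trans ?_
  rcases Nat.eq_zero_or_pos k with rfl | hk0
  · simp
  have hk0' : (0 : ℝ) < k := by exact_mod_cast hk0
  have h : |z| + k ≤ k * exp (|z| / k) := by
    have := add_one_le_exp (|z| / k)
    have h2 := mul_le_mul_of_nonneg_left this hk0'.le
    have : k * (|z| / k + 1) = |z| + k := by field_simp
    linarith
  calc (|z| + k) ^ k ≤ (k * exp (|z| / k)) ^ k := by gcongr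
    _ = (k : ℝ) ^ k * exp |z| := by
      rw [mul_pow, ← exp_nat_mul]; congr 2; field_simp
    _ ≤ (n : ℝ) ^ k * exp |z| := by gcongr

/-- The partial Bell polynomial `B_{m,j}` in the derivatives of `h` at `x`. -/
noncomputable def bellCoeff (h : ℝ → ℝ) : ℕ → ℕ → ℝ → ℝ
  | 0, m, _ => if m = 0 then 1 else 0
  | j + 1, m, x => ∑ i ∈ Finset.range m,
      ((m - 1).choose i : ℝ) * iteratedDeriv (i + 1) h x * bellCoeff h j (m - 1 - i) x

theorem bellCoeff_eq_zero (h : ℝ → ℝ) {j m : ℕ} (hm : m < j) (x : ℝ) : bellCoeff h j m x = 0 := by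
  induction j generalizing m with
  | zero => omega
  | succ j ih =>
    rw [bellCoeff]
    refine Finset.sum_eq_zero fun i hi => ?_
    rw [Finset.mem_range] at hi
    rw [ih (by omega), mul_zero]

theorem bellCoeff_succ_succ (h : ℝ → ℝ) (j m : ℕ) (x : ℝ) :
    bellCoeff h (j + 1) (m + 1) x = ∑ i ∈ Finset.range (m + 1),
      (m.choose i : ℝ) * iteratedDeriv (i + 1) h x * bellCoeff h j (m - i) x := by
  simp [bellCoeff]

theorem continuous_bellCoeff {h : ℝ → ℝ} (hh : ContDiff ℝ (⊤ : ℕ∞) h) (j m : ℕ) :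
    Continuous (bellCoeff h j m) := by
  induction j generalizing m with
  | zero => simp only [funext fun x => bellCoeff.eq_1 h m x]; exact continuous_const
  | succ j ih =>
    simp only [funext fun x => bellCoeff.eq_2 h m x j]
    refine continuous_finsetSum _ fun i _ => ?_
    refine (continuous_const.mul ?_).mul (ih _)
    exact hh.continuous_iteratedDeriv _ (by exact_mod_cast le_top)

theorem iteratedDeriv_hermiteFun_comp {h : ℝ → ℝ} (hh : ContDiff ℝ (⊤ : ℕ∞) h) {M m : ℕ}
    (hm : m ≤ M) (k : ℕ) (y x : ℝ) :
    iteratedDeriv m (fun x => hermiteFun k (y - h x)) x =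
      ∑ j ∈ Finset.range (M + 1), bellCoeff h j m x * hermiteFun (k + j) (y - h x) := by
  induction m using Nat.strong_induction_on generalizing M k x with
  | _ m ih =>
  rcases m with _ | m
  · rw [Finset.sum_eq_single 0]
    · simp [bellCoeff]
    · intro j _ hj
      rw [bellCoeff_eq_zero h (Nat.pos_of_ne_zero hj), zero_mul]
    · simp
  obtain ⟨M, rfl⟩ : ∃ M', M = M' + 1 := ⟨M - 1, by omega⟩
  have hd : deriv (fun x => hermiteFun k (y - h x)) =
      deriv h * fun x => hermiteFun (k + 1) (y - h x) := by
    funext x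
    have h1 : HasDerivAt h (deriv h x) x :=
      (hh.differentiable (by simp)).differentiableAt.hasDerivAt
    have := (hasDerivAt_hermiteFun k (y - h x)).comp x (h1.const_sub y)
    rw [show (fun x => hermiteFun k (y - h x)) = hermiteFun k ∘ fun x => y - h x from rfl,
      this.deriv]
    simp [mul_comm]
  have hdh : ContDiff ℝ (⊤ : ℕ∞) (deriv h) := by
    have := ((contDiff_succ_iff_deriv (n := ((⊤ : ℕ∞) : WithTop ℕ∞)) (𝕜 := ℝ) (f := h)).1
      (by simpa using hh))
    exact this.2.2
  rw [iteratedDeriv_succ', hd, iteratedDeriv_mul]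
  · rw [Finset.sum_range_succ' _ (M + 1)]
    simp only [bellCoeff_succ_succ, Finset.sum_mul]
    rw [Finset.sum_comm]
    have h0 : bellCoeff h 0 (m + 1) x = 0 := by simp [bellCoeff]
    rw [h0, zero_mul, add_zero]
    refine Finset.sum_congr rfl fun i hi => ?_
    rw [Finset.mem_range] at hi
    rw [ih (m - i) (by omega) (M := M) (by omega), ← iteratedDeriv_succ', Finset.mul_sum]
    refine Finset.sum_congr rfl fun j _ => ?_
    rw [show k + 1 + j = k + (j + 1) by ring]
    ring
  · exact (hdh.of_le (by exact_mod_cast le_top)).contDiffAt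
  · refine ContDiff.contDiffAt ?_
    exact (contDiff_hermiteFun _).comp (contDiff_const.sub (hh.of_le (by exact_mod_cast le_top)))

theorem sum_abs_bellCoeff_le {h : ℝ → ℝ} {x q A B Z : ℝ} {n : ℕ} (hq : 0 < q) (hB : 0 ≤ B)
    (hA : ∑ i ∈ Finset.Icc 1 n, |iteratedDeriv i h x| / (q ^ i * (i.factorial : ℝ)) ≤ A)
    (hZ : B * A ≤ Z) (hn : 2 * (n : ℝ) ≤ Z) {m M : ℕ} (hm : m ≤ n) (hM : m ≤ M) :
    ∑ j ∈ Finset.range (M + 1), |bellCoeff h j m x| * B ^ j ≤ (q * Z) ^ m := by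
  have hn0 : (0 : ℝ) ≤ n := Nat.cast_nonneg n
  have hZ0 : 0 ≤ Z := by linarith
  induction m using Nat.strong_induction_on generalizing M with
  | _ m ih =>
  rcases m with _ | m
  · rw [Finset.sum_eq_single 0]
    · simp [bellCoeff]
    · intro j _ hj
      rw [bellCoeff_eq_zero h (Nat.pos_of_ne_zero hj), abs_zero, zero_mul]
    · simp
  obtain ⟨M, rfl⟩ : ∃ M', M = M' + 1 := ⟨M - 1, by omega⟩
  rw [Finset.sum_range_succ' _ (M + 1)]
  have h0 : bellCoeff h 0 (m + 1) x = 0 := by simp [bellCoeff]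
  rw [h0, abs_zero, zero_mul, add_zero]
  set a : ℕ → ℝ := fun i => |iteratedDeriv i h x| / (q ^ i * (i.factorial : ℝ)) with ha
  have ha0 : ∀ i, 0 ≤ a i := fun i => by simp only [ha]; positivity
  have habs : ∀ i, |iteratedDeriv i h x| = a i * (q ^ i * (i.factorial : ℝ)) := fun i => by
    simp only [ha]; field_simp
  have hcoef : ∀ i ≤ m, (m.choose i : ℝ) * ((i + 1).factorial : ℝ) ≤ Z ^ i := by
    intro i hi
    have h1 : m.choose i * i.factorial ≤ m ^ i := by
      rw [mul_comm, ← Nat.descFactorial_eq_factorial_mul_choose]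
      exact Nat.descFactorial_le_pow m i
    have h2 : i + 1 ≤ 2 ^ i := Nat.lt_two_pow_self
    have h3 : m.choose i * (i + 1).factorial ≤ (2 * n) ^ i := by
      calc m.choose i * (i + 1).factorial = (i + 1) * (m.choose i * i.factorial) := by
            rw [Nat.factorial_succ]; ring
        _ ≤ 2 ^ i * m ^ i := Nat.mul_le_mul h2 h1
        _ = (2 * m) ^ i := (mul_pow _ _ _).symm
        _ ≤ (2 * n) ^ i := Nat.pow_le_pow_left (by omega) i
    calc (m.choose i : ℝ) * ((i + 1).factorial : ℝ) ≤ (2 * (n : ℝ)) ^ i := by exact_mod_cast h3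
      _ ≤ Z ^ i := by gcongr
  have hterm : ∀ j, |bellCoeff h (j + 1) (m + 1) x| * B ^ (j + 1) ≤
      ∑ i ∈ Finset.range (m + 1), B * (a (i + 1) * q ^ (i + 1) * Z ^ i) *
        (|bellCoeff h j (m - i) x| * B ^ j) := by
    intro j
    rw [bellCoeff_succ_succ]
    refine (mul_le_mul_of_nonneg_right (Finset.abs_sum_le_sum_abs _ _) (by positivity)).trans ?_
    rw [Finset.sum_mul]
    refine Finset.sum_le_sum fun i hi => ?_
    rw [Finset.mem_range] at hi
    rw [abs_mul, abs_mul, Nat.abs_cast, habs, pow_succ B]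
    have := hcoef i (by omega)
    calc (m.choose i : ℝ) * (a (i + 1) * (q ^ (i + 1) * ((i + 1).factorial : ℝ))) *
          |bellCoeff h j (m - i) x| * (B ^ j * B)
        = B * (a (i + 1) * q ^ (i + 1) * ((m.choose i : ℝ) * ((i + 1).factorial : ℝ))) *
          (|bellCoeff h j (m - i) x| * B ^ j) := by ring
      _ ≤ _ := by
        have := ha0 (i + 1)
        gcongr
  refine (Finset.sum_le_sum fun j _ => hterm j).trans ?_
  rw [Finset.sum_comm]
  simp_rw [← Finset.mul_sum]
  calc ∑ i ∈ Finset.range (m + 1), B * (a (i + 1) * q ^ (i + 1) * Z ^ i) *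
        ∑ j ∈ Finset.range (M + 1), |bellCoeff h j (m - i) x| * B ^ j
      ≤ ∑ i ∈ Finset.range (m + 1), B * (a (i + 1) * q ^ (i + 1) * Z ^ i) * (q * Z) ^ (m - i) := by
        refine Finset.sum_le_sum fun i hi => ?_
        have := ha0 (i + 1)
        exact mul_le_mul_of_nonneg_left (ih (m - i) (by omega) (by omega) (by omega))
          (by positivity)
    _ = q ^ (m + 1) * Z ^ m * (B * ∑ i ∈ Finset.range (m + 1), a (i + 1)) := by
        rw [Finset.mul_sum, Finset.mul_sum]
        refine Finset.sum_congr rfl fun i hi => ?_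
        rw [Finset.mem_range] at hi
        obtain ⟨d, rfl⟩ : ∃ d, m = i + d := ⟨m - i, by omega⟩
        rw [Nat.add_sub_cancel_left, mul_pow]
        ring
    _ ≤ q ^ (m + 1) * Z ^ m * Z := by
        refine mul_le_mul_of_nonneg_left (le_trans ?_ hZ) (by positivity)
        refine mul_le_mul_of_nonneg_left (le_trans ?_ hA) hB
        rw [Finset.range_eq_Ico, Finset.sum_Ico_add' a 0 (m + 1) 1]
        refine Finset.sum_le_sum_of_subset_of_nonneg ?_ fun i _ _ => ha0 i
        intro i
        simp only [Finset.mem_Ico, Finset.mem_Icc]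
        omega
    _ = (q * Z) ^ (m + 1) := by rw [mul_pow]; ring

/-- The unnormalised Gaussian `e^{-z²/4} / √(2π)`, of total mass `√2`. -/
noncomputable def wideDens (z : ℝ) : ℝ := (1 / √(2 * π)) * exp (-(1 / 4) * z ^ 2)

theorem wideDens_nonneg (z : ℝ) : 0 ≤ wideDens z := by unfold wideDens; positivity

theorem integrable_wideDens : Integrable wideDens :=
  (integrable_exp_neg_mul_sq (by norm_num : (0 : ℝ) < 1 / 4)).const_mul _

theorem integral_wideDens : ∫ z, wideDens z = √2 := by
  unfold wideDens
  rw [integral_const_mul, integral_gaussian, one_div, ← div_eq_inv_mul,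
    ← Real.sqrt_div (by positivity)]
  congr 1
  field_simp
  norm_num

theorem integrable_gaussDens : Integrable gaussDens := by
  have := (integrable_exp_neg_mul_sq (by norm_num : (0 : ℝ) < 1 / 2)).const_mul (1 / √(2 * π))
  refine this.congr (Eventually.of_forall fun z => ?_)
  simp only [gaussDens]
  congr 2; ring

theorem integral_gaussDens : ∫ z, gaussDens z = 1 := by
  have h : gaussDens = fun z => (1 / √(2 * π)) * exp (-(1 / 2) * z ^ 2) := by
    funext z; simp only [gaussDens]; congr 2; ring
  rw [h, integral_const_mul, integral_gaussian, one_div, ← div_eq_inv_mul,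
    ← Real.sqrt_div (by positivity)]
  rw [Real.sqrt_eq_one]
  field_simp

theorem gaussDens_mul_exp_le {a c z : ℝ} (h : a - z ^ 2 / 2 ≤ c - z ^ 2 / 4) :
    exp a * gaussDens z ≤ exp c * wideDens z := by
  have h1 : exp a * gaussDens z = (1 / √(2 * π)) * exp (a - z ^ 2 / 2) := by
    rw [gaussDens, mul_left_comm, ← exp_add]; congr 2; ring
  have h2 : exp c * wideDens z = (1 / √(2 * π)) * exp (c - z ^ 2 / 4) := by
    rw [wideDens, mul_left_comm, ← exp_add]; congr 2; ring
  rw [h1, h2]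
  gcongr

theorem gaussEnv_le (z : ℝ) : gaussEnv z ≤ exp 1 * wideDens z := by
  refine gaussDens_mul_exp_le ?_
  nlinarith [sq_nonneg (|z| - 2), sq_abs z]

theorem gaussEnv_le_of_le {R z : ℝ} (hR : 8 ≤ R) (hz : R ≤ |z|) :
    gaussEnv z ≤ exp (-R ^ 2 / 8) * wideDens z := by
  refine gaussDens_mul_exp_le ?_
  rw [← sq_abs z]
  nlinarith

theorem integrable_gaussEnv : Integrable gaussEnv := by
  refine (integrable_wideDens.const_mul (exp 1)).mono' continuous_gaussEnv.aestronglyMeasurable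
    (Eventually.of_forall fun z => ?_)
  rw [norm_of_nonneg (gaussEnv_nonneg z)]
  exact gaussEnv_le z

theorem exp_one_mul_sqrt_two_le : exp 1 * √2 ≤ 4 := by
  have h1 : exp 1 ≤ 2.7182818286 := exp_one_lt_d9.le
  have h2 : √2 ≤ 1.4143 := by
    rw [Real.sqrt_le_left (by norm_num)]; norm_num
  calc exp 1 * √2 ≤ 2.7182818286 * 1.4143 := by gcongr
    _ ≤ 4 := by norm_num

theorem integral_gaussEnv_le : ∫ z, gaussEnv z ≤ 4 := by
  refine (integral_mono integrable_gaussEnv (integrable_wideDens.const_mul (exp 1))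
    gaussEnv_le).trans ?_
  rw [integral_const_mul, integral_wideDens]
  exact exp_one_mul_sqrt_two_le

theorem integrable_hermiteFun (k : ℕ) : Integrable (hermiteFun k) := by
  refine (integrable_gaussEnv.const_mul ((k : ℝ) ^ k)).mono'
    (continuous_hermiteFun k).aestronglyMeasurable (Eventually.of_forall fun z => ?_)
  exact abs_hermiteFun_le le_rfl z

theorem integral_hermiteFun_succ (k : ℕ) : ∫ z, hermiteFun (k + 1) z = 0 := by
  have := integral_eq_zero_of_hasDerivAt_of_integrable (fun z => hasDerivAt_hermiteFun k z)
    (integrable_hermiteFun (k + 1)).neg (integrable_hermiteFun k)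
  rwa [integral_neg, neg_eq_zero] at this

theorem integrable_pow_mul_gaussDens (j : ℕ) : Integrable fun z : ℝ => z ^ j * gaussDens z := by
  have := (integrable_rpow_mul_exp_neg_mul_sq (by norm_num : (0 : ℝ) < 1 / 2)
    (s := j) (by linarith [Nat.cast_nonneg (α := ℝ) j])).const_mul (1 / √(2 * π))
  refine this.congr (Eventually.of_forall fun z => ?_)
  simp only [gaussDens, rpow_natCast]
  rw [mul_left_comm]
  congr 3; ring

theorem integral_pow_mul_gaussDens_add_two (j : ℕ) :
    ∫ z : ℝ, z ^ (j + 2) * gaussDens z = (j + 1) * ∫ z : ℝ, z ^ j * gaussDens z := by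
  have hd : ∀ z : ℝ, HasDerivAt (fun z => z ^ (j + 1) * gaussDens z)
      ((j + 1) * (z ^ j * gaussDens z) - z ^ (j + 2) * gaussDens z) z := by
    intro z
    refine ((hasDerivAt_pow (j + 1) z).mul (hasDerivAt_gaussDens z)).congr_deriv ?_
    push_cast
    simp
    ring
  have h := integral_eq_zero_of_hasDerivAt_of_integrable hd
    (((integrable_pow_mul_gaussDens j).const_mul _).sub (integrable_pow_mul_gaussDens (j + 2)))
    (integrable_pow_mul_gaussDens (j + 1))
  rw [integral_sub ((integrable_pow_mul_gaussDens j).const_mul _)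
    (integrable_pow_mul_gaussDens (j + 2)), integral_const_mul] at h
  linarith

theorem integral_pow_odd_mul_gaussDens (i : ℕ) : ∫ z : ℝ, z ^ (2 * i + 1) * gaussDens z = 0 := by
  induction i with
  | zero =>
    have := integral_hermiteFun_succ 0
    simpa [hermiteFun, hermiteEval] using this
  | succ i ih =>
    rw [show 2 * (i + 1) + 1 = (2 * i + 1) + 2 by ring, integral_pow_mul_gaussDens_add_two, ih,
      mul_zero]

theorem integral_pow_even_mul_gaussDens (i : ℕ) :
    ∫ z : ℝ, z ^ (2 * i) * gaussDens z = ((2 * i).factorial : ℝ) / (2 ^ i * (i.factorial : ℝ)) := by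
  induction i with
  | zero => simp [integral_gaussDens]
  | succ i ih =>
    rw [show 2 * (i + 1) = 2 * i + 2 by ring, integral_pow_mul_gaussDens_add_two, ih,
      Nat.factorial_succ (2 * i + 1), Nat.factorial_succ (2 * i), Nat.factorial_succ i]
    push_cast
    field_simp
    ring

theorem abs_kernelCoeff_le (k : ℕ) :
    |(-1 : ℝ) ^ k * 1 ^ (2 * k) / (2 ^ k * (k.factorial : ℝ))| ≤ (1 / 2) ^ k := by
  rw [abs_div, one_pow, mul_one, abs_pow, abs_neg, abs_one, one_pow,
    abs_of_pos (by positivity), one_div_pow]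
  have : (1 : ℝ) ≤ k.factorial := by exact_mod_cast k.factorial_pos
  gcongr
  nlinarith [pow_pos (two_pos : (0 : ℝ) < 2) k]

theorem sum_half_pow_le (n : ℕ) : ∑ k ∈ Finset.range n, (1 / 2 : ℝ) ^ k ≤ 2 := by
  rw [geom_sum_eq (by norm_num)]
  have : (0 : ℝ) < (1 / 2) ^ n := by positivity
  rw [div_le_iff_of_neg (by norm_num)]
  linarith

/-- `∂_x^m` of the Gaussian link density `φ(y - h(x))`. -/
noncomputable def linkDeriv (h : ℝ → ℝ) (m : ℕ) (y x : ℝ) : ℝ :=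
  iteratedDeriv m (fun x => hermiteFun 0 (y - h x)) x

theorem linkDeriv_zero (h : ℝ → ℝ) (y x : ℝ) : linkDeriv h 0 y x = gaussDens (y - h x) := by
  simp [linkDeriv, hermiteFun_zero]

section linkDeriv

variable {h : ℝ → ℝ} (hh : ContDiff ℝ (⊤ : ℕ∞) h)
include hh

theorem linkDeriv_eq {M m : ℕ} (hm : m ≤ M) (y x : ℝ) : linkDeriv h m y x =
    ∑ j ∈ Finset.range (M + 1), bellCoeff h j m x * hermiteFun j (y - h x) := by
  simp [linkDeriv, iteratedDeriv_hermiteFun_comp hh hm]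

theorem continuous_linkDeriv (m : ℕ) : Continuous fun p : ℝ × ℝ => linkDeriv h m p.1 p.2 := by
  simp only [linkDeriv_eq hh (le_refl m)]
  refine continuous_finsetSum _ fun j _ => ?_
  refine ((continuous_bellCoeff hh j m).comp continuous_snd).mul ?_
  exact (continuous_hermiteFun j).comp (continuous_fst.sub (hh.continuous.comp continuous_snd))

theorem hasDerivAt_linkDeriv (m : ℕ) (y x : ℝ) :
    HasDerivAt (linkDeriv h m y) (linkDeriv h (m + 1) y x) x := by
  have hF : ContDiff ℝ (⊤ : ℕ∞) fun x => hermiteFun 0 (y - h x) :=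
    (contDiff_hermiteFun 0).comp (contDiff_const.sub hh)
  have := (hF.differentiable_iteratedDeriv m (by exact_mod_cast WithTop.coe_lt_top m)).differentiableAt
    (x := x) |>.hasDerivAt
  rwa [← iteratedDeriv_succ] at this

theorem integrable_linkDeriv (m : ℕ) (x : ℝ) : Integrable fun y => linkDeriv h m y x := by
  simp only [linkDeriv_eq hh (le_refl m)]
  exact integrable_finsetSum _ fun j _ =>
    ((integrable_hermiteFun j).comp_sub_right (h x)).const_mul _

theorem integral_linkDeriv_succ (m : ℕ) (x : ℝ) : ∫ y, linkDeriv h (m + 1) y x = 0 := by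
  simp only [linkDeriv_eq hh (le_refl (m + 1))]
  rw [integral_finsetSum _ fun j _ =>
    ((integrable_hermiteFun j).comp_sub_right (h x)).const_mul _]
  refine Finset.sum_eq_zero fun j _ => ?_
  rw [integral_const_mul, integral_sub_right_eq_self (hermiteFun j)]
  rcases j with _ | j
  · simp [bellCoeff]
  · rw [integral_hermiteFun_succ, mul_zero]

omit hh in
theorem integral_linkDeriv_zero (x : ℝ) : ∫ y, linkDeriv h 0 y x = 1 := by
  simp only [linkDeriv_zero]
  rw [integral_sub_right_eq_self gaussDens, integral_gaussDens]

theorem abs_linkDeriv_le {x q A : ℝ} {n m : ℕ} (hq : 0 < q)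
    (hA : ∑ i ∈ Finset.Icc 1 n, |iteratedDeriv i h x| / (q ^ i * (i.factorial : ℝ)) ≤ A)
    (hA1 : 1 ≤ A) (hm : m ≤ n) (y : ℝ) :
    |linkDeriv h m y x| ≤ (q * (2 * n * A)) ^ m * gaussEnv (y - h x) := by
  have hn : (0 : ℝ) ≤ n := Nat.cast_nonneg n
  have hb := sum_abs_bellCoeff_le (B := n) (Z := 2 * n * A) hq hn hA (by nlinarith)
    (by nlinarith) hm hm
  rw [linkDeriv_eq hh hm]
  refine (Finset.abs_sum_le_sum_abs _ _).trans ?_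
  refine le_trans ?_ (mul_le_mul_of_nonneg_right hb (gaussEnv_nonneg _))
  rw [Finset.sum_mul]
  refine Finset.sum_le_sum fun j hj => ?_
  rw [abs_mul, mul_assoc]
  exact mul_le_mul_of_nonneg_left
    (abs_hermiteFun_le (Nat.lt_succ_iff.1 (Finset.mem_range.1 hj)) _) (abs_nonneg _)

theorem abs_linkDeriv_le_gaussDens {x y q A b Z : ℝ} {n m : ℕ} (hq : 0 < q)
    (hA : ∑ i ∈ Finset.Icc 1 n, |iteratedDeriv i h x| / (q ^ i * (i.factorial : ℝ)) ≤ A)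
    (hZ : 2 * b * A ≤ Z) (hnZ : 2 * (n : ℝ) ≤ Z) (hb : n ≤ b ^ 2) (hm : m ≤ n)
    (hy : |y - h x| ≤ b) :
    |linkDeriv h m y x| ≤ (q * Z) ^ m * gaussDens (y - h x) := by
  have hb0 : 0 ≤ b := (abs_nonneg _).trans hy
  have hs := sum_abs_bellCoeff_le (B := 2 * b) (Z := Z) hq (by positivity) hA hZ hnZ hm hm
  rw [linkDeriv_eq hh hm]
  refine (Finset.abs_sum_le_sum_abs _ _).trans ?_
  refine le_trans ?_ (mul_le_mul_of_nonneg_right hs (gaussDens_pos _).le)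
  rw [Finset.sum_mul]
  refine Finset.sum_le_sum fun j hj => ?_
  have hj' : j ≤ n := Nat.lt_succ_iff.1 (Finset.mem_range.1 hj)
  rw [abs_mul, mul_assoc, hermiteFun, abs_mul, abs_of_pos (gaussDens_pos _)]
  refine mul_le_mul_of_nonneg_left (mul_le_mul_of_nonneg_right ?_ (gaussDens_pos _).le)
    (abs_nonneg _)
  exact abs_hermiteEval_le_of_abs_le hy j (le_trans (by exact_mod_cast hj') hb)

end linkDeriv

theorem signedKernel_eq_sum (h : ℝ → ℝ) (N : ℕ) (y x : ℝ) :
    signedKernel 1 (fun y x => hermiteFun 0 (y - h x)) N y x =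
      ∑ k ∈ Finset.range (N + 1), ((-1 : ℝ) ^ k * 1 ^ (2 * k) / (2 ^ k * (k.factorial : ℝ))) *
        linkDeriv h (2 * k) y x := rfl

theorem linkDensity_eq (f : ℝ → ℝ) (τ : ℝ) :
    linkDensity f τ = fun y x => hermiteFun 0 (y - (fun θ => f (θ / τ)) x) := by
  funext y x
  rw [hermiteFun_zero]
  rfl

theorem srcDensity_one (θ x : ℝ) : srcDensity 1 θ x = gaussDens (x - θ) := by
  simp [srcDensity, gaussDens]

theorem abs_signedKernel_le {h : ℝ → ℝ} {N : ℕ} {x y δ K : ℝ} (hδ0 : 0 ≤ δ) (hδ : δ ≤ 1)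
    (hK : 0 ≤ K) (hV : ∀ m ≤ 2 * N, |linkDeriv h m y x| ≤ δ ^ m * K) :
    |signedKernel 1 (fun y x => hermiteFun 0 (y - h x)) N y x| ≤ 2 * K := by
  rw [signedKernel_eq_sum]
  refine (Finset.abs_sum_le_sum_abs _ _).trans ?_
  refine le_trans ?_ (mul_le_mul_of_nonneg_right (sum_half_pow_le (N + 1)) hK)
  rw [Finset.sum_mul]
  refine Finset.sum_le_sum fun k hk => ?_
  rw [Finset.mem_range] at hk
  rw [abs_mul]
  refine mul_le_mul (abs_kernelCoeff_le k) ((hV _ (by omega)).trans ?_) (abs_nonneg _)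
    (by positivity)
  exact mul_le_of_le_one_left hK (pow_le_one₀ hδ0 hδ)

theorem signedKernel_nonneg_of_abs_le {h : ℝ → ℝ} {N : ℕ} {x y δ : ℝ} (hδ0 : 0 ≤ δ) (hδ : δ ≤ 1)
    (hV : ∀ m ≤ 2 * N, |linkDeriv h m y x| ≤ δ ^ m * gaussDens (y - h x)) :
    0 ≤ signedKernel 1 (fun y x => hermiteFun 0 (y - h x)) N y x := by
  have hg := (gaussDens_pos (y - h x)).le
  rw [signedKernel_eq_sum, Finset.sum_range_succ']
  have h1 : |∑ k ∈ Finset.range N, ((-1 : ℝ) ^ (k + 1) * 1 ^ (2 * (k + 1)) /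
      (2 ^ (k + 1) * ((k + 1).factorial : ℝ))) * linkDeriv h (2 * (k + 1)) y x| ≤
      gaussDens (y - h x) := by
    refine (Finset.abs_sum_le_sum_abs _ _).trans ?_
    have hs : (∑ k ∈ Finset.range N, (1 / 2 : ℝ) ^ (k + 1)) ≤ 1 := by
      have := sum_half_pow_le (N + 1)
      rw [Finset.sum_range_succ'] at this
      norm_num at this ⊢
      linarith
    refine le_trans ?_ ((mul_le_mul_of_nonneg_right hs hg).trans (one_mul _).le)
    rw [Finset.sum_mul]
    refine Finset.sum_le_sum fun k hk => ?_
    rw [Finset.mem_range] at hk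
    rw [abs_mul]
    refine mul_le_mul (abs_kernelCoeff_le (k + 1)) ((hV _ (by omega)).trans ?_) (abs_nonneg _)
      (by positivity)
    exact mul_le_of_le_one_left hg (pow_le_one₀ hδ0 hδ)
  have h2 := neg_le_of_abs_le h1
  simp only [mul_zero, linkDeriv_zero, pow_zero, Nat.factorial_zero, Nat.cast_one, mul_one,
    div_one, one_mul]
  linarith

section kernel

variable {h : ℝ → ℝ} (hh : ContDiff ℝ (⊤ : ℕ∞) h)
include hh

theorem integrable_signedKernel (N : ℕ) (x : ℝ) :
    Integrable fun y => signedKernel 1 (fun y x => hermiteFun 0 (y - h x)) N y x := by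
  simp only [signedKernel_eq_sum]
  exact integrable_finsetSum _ fun k _ => (integrable_linkDeriv hh _ x).const_mul _

theorem integral_signedKernel (N : ℕ) (x : ℝ) :
    ∫ y, signedKernel 1 (fun y x => hermiteFun 0 (y - h x)) N y x = 1 := by
  simp only [signedKernel_eq_sum]
  rw [integral_finsetSum _ fun k _ => (integrable_linkDeriv hh _ x).const_mul _,
    Finset.sum_eq_single 0]
  · rw [integral_const_mul, mul_zero, integral_linkDeriv_zero]
    simp
  · intro k _ hk
    obtain ⟨k, rfl⟩ := Nat.exists_eq_succ_of_ne_zero hk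
    rw [integral_const_mul, show 2 * (k.succ) = (2 * k + 1) + 1 by omega,
      integral_linkDeriv_succ hh, mul_zero]
  · simp

theorem abs_pFun_sub_one (N : ℕ) (x : ℝ) :
    |pFun 1 (fun y x => hermiteFun 0 (y - h x)) N x - 1| =
      qFun 1 (fun y x => hermiteFun 0 (y - h x)) N x := by
  have hi := integrable_signedKernel hh N x
  have h0 : Integrable fun _ : ℝ => (0 : ℝ) := integrable_zero _ _ _
  have hp : pFun 1 (fun y x => hermiteFun 0 (y - h x)) N x -
      qFun 1 (fun y x => hermiteFun 0 (y - h x)) N x = 1 := by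
    rw [pFun, qFun, sub_neg_eq_add]
    refine (integral_add (hi.sup h0) (hi.inf h0)).symm.trans ?_
    refine Eq.trans ?_ (integral_signedKernel hh N x)
    refine integral_congr_ae (Eventually.of_forall fun y => ?_)
    simp [max_add_min]
  have hq : 0 ≤ qFun 1 (fun y x => hermiteFun 0 (y - h x)) N x := by
    rw [qFun, ← integral_neg]
    exact integral_nonneg fun y => by simp
  rw [show pFun 1 (fun y x => hermiteFun 0 (y - h x)) N x - 1 =
    qFun 1 (fun y x => hermiteFun 0 (y - h x)) N x by linarith, abs_of_nonneg hq]

omit hh in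
theorem qFun_le_of_le {N : ℕ} {x : ℝ} {g : ℝ → ℝ} (hg : Integrable g)
    (hle : ∀ z, -min (signedKernel 1 (fun y x => hermiteFun 0 (y - h x)) N (z + h x) x) 0 ≤ g z) :
    qFun 1 (fun y x => hermiteFun 0 (y - h x)) N x ≤ ∫ z, g z := by
  rw [qFun, ← integral_neg, ← integral_sub_right_eq_self g (h x)]
  refine integral_mono_of_nonneg (Eventually.of_forall fun y => by simp) (hg.comp_sub_right _)
    (Eventually.of_forall fun y => ?_)
  simpa using hle (y - h x)

omit hh in
theorem qFun_le {N : ℕ} {x δ K : ℝ} (hδ0 : 0 ≤ δ) (hδ : δ ≤ 1) (hK : 0 ≤ K)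
    (hV : ∀ y, ∀ m ≤ 2 * N, |linkDeriv h m y x| ≤ δ ^ m * (K * gaussEnv (y - h x))) :
    qFun 1 (fun y x => hermiteFun 0 (y - h x)) N x ≤ 8 * K := by
  refine (qFun_le_of_le (g := fun z => 2 * K * gaussEnv z) (integrable_gaussEnv.const_mul _)
    fun z => ?_).trans ?_
  · have h1 := abs_signedKernel_le hδ0 hδ (mul_nonneg hK (gaussEnv_nonneg _)) (hV (z + h x))
    rw [add_sub_cancel_right] at h1
    have h2 := neg_le_of_abs_le h1
    have h3 := mul_nonneg hK (gaussEnv_nonneg z)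
    rw [neg_le]
    exact le_min (by linarith) (by linarith)
  · rw [integral_const_mul]
    nlinarith [integral_gaussEnv_le]

omit hh in
theorem qFun_le_of_nonneg {N : ℕ} {x δ K R : ℝ} (hδ0 : 0 ≤ δ) (hδ : δ ≤ 1) (hK : 0 ≤ K)
    (hR : 8 ≤ R)
    (hV : ∀ y, ∀ m ≤ 2 * N, |linkDeriv h m y x| ≤ δ ^ m * (K * gaussEnv (y - h x)))
    (hpos : ∀ y, |y - h x| ≤ R → 0 ≤ signedKernel 1 (fun y x => hermiteFun 0 (y - h x)) N y x) :
    qFun 1 (fun y x => hermiteFun 0 (y - h x)) N x ≤ 2 * K * exp (-R ^ 2 / 8) * √2 := by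
  refine (qFun_le_of_le (g := fun z => 2 * K * exp (-R ^ 2 / 8) * wideDens z)
    (integrable_wideDens.const_mul _) fun z => ?_).trans ?_
  · have hw : 0 ≤ 2 * K * exp (-R ^ 2 / 8) * wideDens z :=
      mul_nonneg (by positivity) (wideDens_nonneg z)
    rcases le_or_gt |z| R with hz | hz
    · rw [min_eq_right (hpos (z + h x) (by rwa [add_sub_cancel_right])), neg_zero]
      exact hw
    have h1 := abs_signedKernel_le hδ0 hδ (mul_nonneg hK (gaussEnv_nonneg _)) (hV (z + h x))
    rw [add_sub_cancel_right] at h1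
    have h2 := neg_le_of_abs_le h1
    have h3 := mul_le_mul_of_nonneg_left (gaussEnv_le_of_le hR hz.le) hK
    rw [neg_le]
    exact le_min (by linarith) (by linarith)
  · rw [integral_const_mul, integral_wideDens]

end kernel

/-- Quantitative bounds on the derivatives of a rescaled link function `h`, at scale `τ` and up to
order `2 * N`. -/
structure LinkBounds (h : ℝ → ℝ) (N : ℕ) (q L α τ : ℝ) : Prop where
  smooth : ContDiff ℝ (⊤ : ℕ∞) h
  q_pos : 0 < q
  one_le_L : 1 ≤ L
  α_nonneg : 0 ≤ α
  sum_le : ∀ x, |x| ≤ τ →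
    ∑ i ∈ Finset.Icc 1 (2 * N), |iteratedDeriv i h x| / (q ^ i * (i.factorial : ℝ)) ≤ L
  sum_le_exp : ∀ x, τ ≤ |x| →
    ∑ i ∈ Finset.Icc 1 (2 * N), |iteratedDeriv i h x| / (q ^ i * (i.factorial : ℝ)) ≤
      L * exp (x ^ 2 / (16 * N))
  deriv_le : ∀ x, x ^ 2 ≤ τ ^ 2 / 8 → |iteratedDeriv 1 h x| / q ≤ α
  mul_L_le : 256 * q * L * N ≤ 1
  mul_sqrt_le : 2 * q * √τ * (α + 1) ≤ 1
  le_N : 1000 ≤ N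
  N_le : 2 * N ≤ τ

namespace LinkBounds

variable {h : ℝ → ℝ} {N : ℕ} {q L α τ : ℝ}

theorem tau_ge (B : LinkBounds h N q L α τ) : 2000 ≤ τ := by
  have h1 : (1000 : ℝ) ≤ N := by exact_mod_cast B.le_N
  linarith [B.N_le]

theorem sq_div_eight_le {θ ξ : ℝ} (hθ : |θ| ≤ τ / 256) (hx : τ ≤ |θ + ξ|) :
    (θ + ξ) ^ 2 / 8 ≤ ξ ^ 2 / 7 := by
  have h1 : |θ + ξ| ≤ |θ| + |ξ| := abs_add_le _ _
  have h2 : 255 / 256 * |θ + ξ| ≤ |ξ| := by linarith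
  have h3 := pow_le_pow_left₀ (by positivity) h2 2
  rw [mul_pow, sq_abs, sq_abs] at h3
  linarith [sq_nonneg (θ + ξ)]

theorem abs_linkDeriv_le_of_le (B : LinkBounds h N q L α τ) {m : ℕ} (hm : m ≤ 2 * N) {x : ℝ}
    (hx : |x| ≤ τ) (y : ℝ) : |linkDeriv h m y x| ≤ (1 / 64) ^ m * gaussEnv (y - h x) := by
  refine (abs_linkDeriv_le B.smooth B.q_pos (B.sum_le x hx) B.one_le_L hm y).trans ?_
  have h1 := B.mul_L_le
  have := B.q_pos
  have := B.one_le_L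
  refine mul_le_mul_of_nonneg_right (pow_le_pow_left₀ (by positivity) ?_ _) (gaussEnv_nonneg _)
  push_cast
  linarith

theorem abs_linkDeriv_le (B : LinkBounds h N q L α τ) {m : ℕ} (hm : m ≤ 2 * N) {θ : ℝ}
    (hθ : |θ| ≤ τ / 256) (ξ y : ℝ) :
    |linkDeriv h m y (θ + ξ)| ≤
      (1 / 64) ^ m * (exp (ξ ^ 2 / 7) * gaussEnv (y - h (θ + ξ))) := by
  have hg := gaussEnv_nonneg (y - h (θ + ξ))
  rcases le_or_gt |θ + ξ| τ with hx | hx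
  · refine (B.abs_linkDeriv_le_of_le hm hx y).trans ?_
    refine mul_le_mul_of_nonneg_left ?_ (by positivity)
    exact le_mul_of_one_le_left hg (one_le_exp (by positivity))
  · have hN : (0 : ℝ) < N := by exact_mod_cast (by have := B.le_N; omega : 0 < N)
    have hL := B.one_le_L
    have hq := B.q_pos
    refine (_root_.abs_linkDeriv_le B.smooth B.q_pos (B.sum_le_exp _ hx.le) ?_ hm y).trans ?_
    · exact one_le_mul_of_one_le_of_one_le hL (one_le_exp (by positivity))
    rw [← mul_assoc ((1 / 64 : ℝ) ^ m)]
    refine mul_le_mul_of_nonneg_right ?_ hg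
    have h1 : q * (2 * ((2 * N : ℕ) : ℝ) * (L * exp ((θ + ξ) ^ 2 / (16 * N)))) ≤
        1 / 64 * exp ((θ + ξ) ^ 2 / (16 * N)) := by
      have h2 := B.mul_L_le
      have h3 : q * (2 * ((2 * N : ℕ) : ℝ) * L) ≤ 1 / 64 := by push_cast; linarith
      calc _ = q * (2 * ((2 * N : ℕ) : ℝ) * L) * exp ((θ + ξ) ^ 2 / (16 * N)) := by ring
        _ ≤ _ := mul_le_mul_of_nonneg_right h3 (exp_pos _).le
    refine (pow_le_pow_left₀ (by positivity) h1 m).trans ?_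
    rw [mul_pow, ← exp_nat_mul]
    refine mul_le_mul_of_nonneg_left (exp_le_exp.mpr ?_) (by positivity)
    refine le_trans ?_ (sq_div_eight_le hθ hx.le)
    have h3 : (m : ℝ) ≤ 2 * N := by exact_mod_cast hm
    calc (m : ℝ) * ((θ + ξ) ^ 2 / (16 * N)) ≤ 2 * N * ((θ + ξ) ^ 2 / (16 * N)) := by gcongr
      _ = (θ + ξ) ^ 2 / 8 := by field_simp; ring

theorem sum_mul_le (B : LinkBounds h N q L α τ) {x : ℝ} (hx : x ^ 2 ≤ τ ^ 2 / 8) :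
    ∑ i ∈ Finset.Icc 1 (2 * N), |iteratedDeriv i h x| / ((q * L) ^ i * (i.factorial : ℝ)) ≤
      (α + 1) / L := by
  have hL := B.one_le_L
  have hL0 : 0 < L := by linarith
  have hq := B.q_pos
  have hτ := B.tau_ge
  have hN := B.le_N
  have hxτ : |x| ≤ τ := abs_le_of_sq_le_sq (by nlinarith) (by linarith)
  have hS := B.sum_le x hxτ
  have hd := B.deriv_le x hx
  have hI : Finset.Icc 1 (2 * N) = insert 1 (Finset.Icc 2 (2 * N)) := by
    ext i; simp only [Finset.mem_Icc, Finset.mem_insert]; omega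
  have h1 : (1 : ℕ) ∉ Finset.Icc 2 (2 * N) := by simp
  rw [hI, Finset.sum_insert h1] at hS ⊢
  have hfirst : |iteratedDeriv 1 h x| / ((q * L) ^ 1 * ((1 : ℕ).factorial : ℝ)) ≤ α / L := by
    calc _ = |iteratedDeriv 1 h x| / q / L := by simp [div_div]
      _ ≤ _ := by gcongr
  have hrest : ∑ i ∈ Finset.Icc 2 (2 * N),
      |iteratedDeriv i h x| / ((q * L) ^ i * (i.factorial : ℝ)) ≤
      (∑ i ∈ Finset.Icc 2 (2 * N), |iteratedDeriv i h x| / (q ^ i * (i.factorial : ℝ))) / L ^ 2 := by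
    rw [Finset.sum_div]
    refine Finset.sum_le_sum fun i hi => ?_
    rw [Finset.mem_Icc] at hi
    rw [div_div]
    refine div_le_div_of_nonneg_left (abs_nonneg _) (by positivity) ?_
    rw [mul_pow]
    have : L ^ 2 ≤ L ^ i := pow_le_pow_right₀ hL hi.1
    calc q ^ i * (i.factorial : ℝ) * L ^ 2 ≤ q ^ i * (i.factorial : ℝ) * L ^ i := by gcongr
      _ = _ := by ring
  have hpos : 0 ≤ |iteratedDeriv 1 h x| / (q ^ 1 * ((1 : ℕ).factorial : ℝ)) := by positivity
  have hrest' : (∑ i ∈ Finset.Icc 2 (2 * N),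
      |iteratedDeriv i h x| / (q ^ i * (i.factorial : ℝ))) / L ^ 2 ≤ 1 / L := by
    rw [div_le_div_iff₀ (by positivity) hL0]
    nlinarith
  calc _ ≤ α / L + 1 / L := add_le_add hfirst (hrest.trans hrest')
    _ = _ := by ring

theorem signedKernel_nonneg (B : LinkBounds h N q L α τ) {x y : ℝ} (hx : x ^ 2 ≤ τ ^ 2 / 8)
    (hy : |y - h x| ≤ √τ) : 0 ≤ signedKernel 1 (fun y x => hermiteFun 0 (y - h x)) N y x := by
  have hL := B.one_le_L
  have hL0 : 0 < L := by linarith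
  have hq := B.q_pos
  have hα := B.α_nonneg
  have hτ := B.tau_ge
  refine signedKernel_nonneg_of_abs_le
    (δ := q * L * max (2 * ((2 * N : ℕ) : ℝ)) (2 * √τ * ((α + 1) / L))) (by positivity) ?_
    fun m hm => abs_linkDeriv_le_gaussDens B.smooth (by positivity) (B.sum_mul_le hx)
      (le_max_right _ _) (le_max_left _ _) ?_ hm hy
  · rw [mul_max_of_nonneg _ _ (by positivity)]
    refine max_le ?_ ?_
    · have h0 : 0 ≤ q * L * N := by positivity
      have h1 := B.mul_L_le
      push_cast
      linarith
    · refine le_trans (le_of_eq ?_) B.mul_sqrt_le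
      field_simp
  · rw [Real.sq_sqrt (by linarith)]
    exact_mod_cast B.N_le

theorem qFun_le_of_sq_le (B : LinkBounds h N q L α τ) {x : ℝ} (hx : x ^ 2 ≤ τ ^ 2 / 8) :
    qFun 1 (fun y x => hermiteFun 0 (y - h x)) N x ≤ 2 * √2 * exp (-τ / 8) := by
  have hτ := B.tau_ge
  have h8 : 8 ≤ √τ := Real.le_sqrt_of_sq_le (by linarith)
  have hxτ : |x| ≤ τ := abs_le_of_sq_le_sq (by nlinarith) (by linarith)
  refine (qFun_le_of_nonneg (δ := 1 / 64) (K := 1) (by norm_num) (by norm_num) zero_le_one h8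
    (fun y m hm => ?_) fun y hy => B.signedKernel_nonneg hx hy).trans (le_of_eq ?_)
  · rw [one_mul]
    exact B.abs_linkDeriv_le_of_le hm hxτ y
  · rw [Real.sq_sqrt (by linarith)]; ring

theorem qFun_mul_le (B : LinkBounds h N q L α τ) {θ : ℝ} (hθ : |θ| ≤ τ / 256) (ξ : ℝ) :
    qFun 1 (fun y x => hermiteFun 0 (y - h x)) N (θ + ξ) * gaussDens ξ ≤
      exp (-τ / 8) * (2 * √2 * gaussDens ξ + 8 * exp (-1) * wideDens ξ) := by
  have hτ := B.tau_ge
  have hg := (gaussDens_pos ξ).le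
  have hw := wideDens_nonneg ξ
  rcases le_or_gt ((θ + ξ) ^ 2) (τ ^ 2 / 8) with hx | hx
  · have h1 := mul_le_mul_of_nonneg_right (B.qFun_le_of_sq_le hx) hg
    have h2 : 0 ≤ exp (-τ / 8) * (8 * exp (-1) * wideDens ξ) := by positivity
    linarith
  · have h1 := mul_le_mul_of_nonneg_right (qFun_le (δ := 1 / 64) (by norm_num) (by norm_num)
      (exp_pos (ξ ^ 2 / 7)).le fun y m hm => B.abs_linkDeriv_le hm hθ ξ y) hg
    have hξ : 0.34 * τ ≤ |ξ| := by
      have h3 : |θ + ξ| ≤ |θ| + |ξ| := abs_add_le _ _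
      have h4 : 0.35 * τ ≤ |θ + ξ| := abs_le_of_sq_le_sq' (a := 0.35 * τ) (by
        rw [sq_abs]; nlinarith) (abs_nonneg _) |>.2
      linarith
    have h5 : exp (ξ ^ 2 / 7) * gaussDens ξ ≤ exp (-τ / 8 - 1) * wideDens ξ := by
      refine gaussDens_mul_exp_le ?_
      have h6 : (0.34 * τ) ^ 2 ≤ ξ ^ 2 := by
        rw [← sq_abs ξ]; exact pow_le_pow_left₀ (by positivity) hξ 2
      nlinarith
    rw [sub_eq_add_neg, exp_add] at h5
    have h2 : 0 ≤ exp (-τ / 8) * (2 * √2 * gaussDens ξ) := by positivity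
    linarith

theorem half_integral_le (B : LinkBounds h N q L α τ) {θ : ℝ} (hθ : |θ| ≤ τ / 256) :
    (1 / 2) * ∫ x, (|pFun 1 (fun y x => hermiteFun 0 (y - h x)) N x - 1| +
      qFun 1 (fun y x => hermiteFun 0 (y - h x)) N x) * srcDensity 1 θ x ≤
      12 * exp (-τ / 8) := by
  rw [← integral_const_mul, ← integral_add_left_eq_self _ θ]
  have hq0 : ∀ x, 0 ≤ qFun 1 (fun y x => hermiteFun 0 (y - h x)) N x := fun x => by
    rw [← abs_pFun_sub_one B.smooth]; exact abs_nonneg _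
  have hint : Integrable fun ξ =>
      exp (-τ / 8) * (2 * √2 * gaussDens ξ + 8 * exp (-1) * wideDens ξ) :=
    ((integrable_gaussDens.const_mul _).add (integrable_wideDens.const_mul _)).const_mul _
  refine (integral_mono_of_nonneg (Eventually.of_forall fun ξ => ?_) hint
    (Eventually.of_forall fun ξ => ?_)).trans ?_
  · have := hq0 (θ + ξ)
    have := (gaussDens_pos ξ).le
    simp only [srcDensity_one, abs_pFun_sub_one B.smooth, add_sub_cancel_left, Pi.zero_apply]
    positivity
  · simp only [srcDensity_one, abs_pFun_sub_one B.smooth, add_sub_cancel_left]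
    refine le_trans (le_of_eq ?_) (B.qFun_mul_le hθ ξ)
    ring
  · rw [integral_const_mul, integral_add (integrable_gaussDens.const_mul _)
      (integrable_wideDens.const_mul _), integral_const_mul, integral_const_mul,
      integral_gaussDens, integral_wideDens, mul_comm 12]
    refine mul_le_mul_of_nonneg_left ?_ (exp_pos _).le
    have h2 : √2 ≤ 1.4143 := by
      rw [Real.sqrt_le_left (by norm_num)]; norm_num
    have h3 : exp (-1) ≤ 1 / 2 := by
      rw [exp_neg, inv_eq_one_div]
      exact one_div_le_one_div_of_le two_pos (by linarith [exp_one_gt_d9])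
    have h4 : exp (-1) * √2 ≤ 1 / 2 * 1.4143 := by gcongr
    linarith

end LinkBounds

section taylor

variable {V : ℕ → ℝ → ℝ} (hV : ∀ m x, HasDerivAt (V m) (V (m + 1) x) x)
include hV

theorem hasDerivAt_taylorSum (a M : ℕ) (θ ξ r : ℝ) :
    HasDerivAt (fun r => ∑ j ∈ Finset.range (M + 1),
        ξ ^ j * (1 - r) ^ j / (j.factorial : ℝ) * V (a + j) (θ + r * ξ))
      ((1 - r) ^ M / (M.factorial : ℝ) * ξ ^ (M + 1) * V (a + M + 1) (θ + r * ξ)) r := by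
  have hcomp : ∀ m, HasDerivAt (fun r => V m (θ + r * ξ)) (V (m + 1) (θ + r * ξ) * ξ) r := by
    intro m
    have h1 : HasDerivAt (fun r => θ + r * ξ) ξ r := by
      simpa using ((hasDerivAt_id r).mul_const ξ).const_add θ
    exact (hV m (θ + r * ξ)).comp r h1
  induction M with
  | zero =>
    simpa [mul_comm] using hcomp a
  | succ M ih =>
    simp only [Finset.sum_range_succ _ (M + 1)]
    have h1 : HasDerivAt (fun r : ℝ => 1 - r) (-1) r := by
      simpa using (hasDerivAt_id r).const_sub 1
    have h2 := (((h1.pow (M + 1)).const_mul (ξ ^ (M + 1))).div_const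
      (((M + 1).factorial : ℕ) : ℝ)).mul (hcomp (a + (M + 1)))
    refine (ih.add h2).congr_deriv ?_
    rw [Nat.factorial_succ, ← add_assoc]
    push_cast
    simp only [Pi.pow_apply]
    field_simp
    ring_nf

theorem sub_taylorSum_eq_integral (a M : ℕ) (θ ξ : ℝ) :
    V a (θ + ξ) - ∑ j ∈ Finset.range (M + 1), ξ ^ j / (j.factorial : ℝ) * V (a + j) θ =
      ∫ r in (0 : ℝ)..1,
        (1 - r) ^ M / (M.factorial : ℝ) * ξ ^ (M + 1) * V (a + M + 1) (θ + r * ξ) := by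
  have hc : Continuous (V (a + M + 1)) :=
    continuous_iff_continuousAt.mpr fun x => (hV _ x).continuousAt
  have := intervalIntegral.integral_eq_sub_of_hasDerivAt
    (fun r _ => hasDerivAt_taylorSum hV a M θ ξ r)
    (Continuous.intervalIntegrable (by fun_prop) 0 1)
  rw [this]
  congr 1
  · rw [Finset.sum_range_succ']
    simp
  · simp

end taylor

theorem sum_range_kernelCoeff_mul {N : ℕ} (hN : 0 < N) (W : ℕ → ℝ) :
    ∑ k ∈ Finset.range (N + 1), ((-1 : ℝ) ^ k * 1 ^ (2 * k) / (2 ^ k * (k.factorial : ℝ))) *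
      ∑ i ∈ Finset.range (N - k), W (k + i) / (2 ^ i * (i.factorial : ℝ)) = W 0 := by
  rw [Finset.sum_range_succ, Nat.sub_self, Finset.sum_range_zero, mul_zero, add_zero]
  simp only [Finset.mul_sum]
  have h1 := Finset.sum_range_diag_flip N fun k i =>
    ((-1 : ℝ) ^ k * 1 ^ (2 * k) / (2 ^ k * (k.factorial : ℝ))) *
      (W (k + i) / (2 ^ i * (i.factorial : ℝ)))
  rw [← h1, Finset.sum_eq_single 0]
  · simp
  · intro s _ hs
    have h2 : ∑ k ∈ Finset.range (s + 1), ((-1 : ℝ) ^ k * (s.choose k : ℝ)) = 0 := by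
      have := Int.alternating_sum_range_choose_of_ne hs
      exact_mod_cast this
    have h3 : ∀ k ∈ Finset.range (s + 1),
        ((-1 : ℝ) ^ k * 1 ^ (2 * k) / (2 ^ k * (k.factorial : ℝ))) *
          (W (k + (s - k)) / (2 ^ (s - k) * ((s - k).factorial : ℝ))) =
        W s / (2 ^ s * (s.factorial : ℝ)) * ((-1 : ℝ) ^ k * (s.choose k : ℝ)) := by
      intro k hk
      have hk' : k ≤ s := by rw [Finset.mem_range] at hk; omega
      rw [Nat.cast_choose ℝ hk', Nat.add_sub_cancel' hk']
      have h4 : (2 : ℝ) ^ s = 2 ^ k * 2 ^ (s - k) := by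
        rw [← pow_add, Nat.add_sub_cancel' hk']
      rw [h4, one_pow]
      field_simp
    rw [Finset.sum_congr rfl h3, ← Finset.mul_sum, h2, mul_zero]
  · intro h; simp at h; omega

theorem sum_range_two_mul (g : ℕ → ℝ) (n : ℕ) : ∑ j ∈ Finset.range (2 * n), g j =
    ∑ i ∈ Finset.range n, (g (2 * i) + g (2 * i + 1)) := by
  induction n with
  | zero => simp
  | succ n ih =>
    rw [show 2 * (n + 1) = 2 * n + 1 + 1 by ring, Finset.sum_range_succ, Finset.sum_range_succ,
      Finset.sum_range_succ, ih]
    ring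

/-- The polynomial in `ξ` approximating the signed kernel `S*_N(y|θ+ξ)`. -/
noncomputable def taylorPart (h : ℝ → ℝ) (N : ℕ) (θ y ξ : ℝ) : ℝ :=
  ∑ k ∈ Finset.range (N + 1), ((-1 : ℝ) ^ k * 1 ^ (2 * k) / (2 ^ k * (k.factorial : ℝ))) *
    ∑ j ∈ Finset.range (2 * (N - k)), ξ ^ j / (j.factorial : ℝ) * linkDeriv h (2 * k + j) y θ

theorem integrable_taylorPart_mul (h : ℝ → ℝ) (N : ℕ) (θ y : ℝ) :
    Integrable fun ξ => taylorPart h N θ y ξ * gaussDens ξ := by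
  simp only [taylorPart, Finset.sum_mul, Finset.mul_sum]
  refine integrable_finsetSum _ fun k _ => integrable_finsetSum _ fun j _ => ?_
  refine ((integrable_pow_mul_gaussDens j).const_mul
    (((-1 : ℝ) ^ k * 1 ^ (2 * k) / (2 ^ k * (k.factorial : ℝ))) *
      (linkDeriv h (2 * k + j) y θ / (j.factorial : ℝ)))).congr (Eventually.of_forall fun ξ => ?_)
  simp only
  ring

theorem integral_taylorPart_mul (h : ℝ → ℝ) {N : ℕ} (hN : 0 < N) (θ y : ℝ) :
    ∫ ξ, taylorPart h N θ y ξ * gaussDens ξ = linkDeriv h 0 y θ := by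
  have hi : ∀ k j, Integrable fun ξ : ℝ =>
      (ξ ^ j / (j.factorial : ℝ) * linkDeriv h (2 * k + j) y θ) * gaussDens ξ := by
    intro k j
    refine ((integrable_pow_mul_gaussDens j).const_mul
      (linkDeriv h (2 * k + j) y θ / (j.factorial : ℝ))).congr (Eventually.of_forall fun ξ => ?_)
    simp only
    ring
  have hval : ∀ k j, ∫ ξ : ℝ, (ξ ^ j / (j.factorial : ℝ) * linkDeriv h (2 * k + j) y θ) *
      gaussDens ξ = linkDeriv h (2 * k + j) y θ / (j.factorial : ℝ) *
        ∫ ξ : ℝ, ξ ^ j * gaussDens ξ := by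
    intro k j
    rw [← integral_const_mul]
    congr 1; funext ξ; ring
  simp only [taylorPart, Finset.sum_mul, mul_assoc _ (Finset.sum _ _)]
  rw [integral_finsetSum _ fun k _ => (integrable_finsetSum _ fun j _ => hi k j).const_mul _,
    ← sum_range_kernelCoeff_mul hN fun s => linkDeriv h (2 * s) y θ]
  refine Finset.sum_congr rfl fun k _ => ?_
  rw [integral_const_mul, integral_finsetSum _ fun j _ => hi k j, sum_range_two_mul]
  congr 1
  refine Finset.sum_congr rfl fun i _ => ?_
  rw [hval, hval, integral_pow_odd_mul_gaussDens, integral_pow_even_mul_gaussDens, mul_zero,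
    add_zero, mul_add]
  have : ((2 * i).factorial : ℝ) ≠ 0 := by positivity
  field_simp

theorem continuous_taylorPart {h : ℝ → ℝ} (hh : ContDiff ℝ (⊤ : ℕ∞) h) (N : ℕ) (θ : ℝ) :
    Continuous fun p : ℝ × ℝ => taylorPart h N θ p.1 p.2 := by
  have h1 : ∀ m, Continuous fun p : ℝ × ℝ => linkDeriv h m p.1 θ := fun m =>
    (continuous_linkDeriv hh m).comp (continuous_fst.prodMk continuous_const)
  unfold taylorPart
  fun_prop

theorem continuous_signedKernel {h : ℝ → ℝ} (hh : ContDiff ℝ (⊤ : ℕ∞) h) (N : ℕ) :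
    Continuous fun p : ℝ × ℝ =>
      signedKernel 1 (fun y x => hermiteFun 0 (y - h x)) N p.1 p.2 := by
  simp only [signedKernel_eq_sum]
  have h1 := fun m => continuous_linkDeriv hh m
  fun_prop

theorem signedKernel_sub_taylorPart (h : ℝ → ℝ) (N : ℕ) (θ y ξ : ℝ) :
    signedKernel 1 (fun y x => hermiteFun 0 (y - h x)) N y (θ + ξ) - taylorPart h N θ y ξ =
      ∑ k ∈ Finset.range (N + 1), ((-1 : ℝ) ^ k * 1 ^ (2 * k) / (2 ^ k * (k.factorial : ℝ))) *
        (linkDeriv h (2 * k) y (θ + ξ) - ∑ j ∈ Finset.range (2 * (N - k)),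
          ξ ^ j / (j.factorial : ℝ) * linkDeriv h (2 * k + j) y θ) := by
  rw [signedKernel_eq_sum, taylorPart, ← Finset.sum_sub_distrib]
  exact Finset.sum_congr rfl fun k _ => by ring

namespace LinkBounds

variable {h : ℝ → ℝ} {N : ℕ} {q L α τ : ℝ}

theorem lintegral_linkDeriv_le (B : LinkBounds h N q L α τ) {m : ℕ} (hm : m ≤ 2 * N) {θ : ℝ}
    (hθ : |θ| ≤ τ / 256) (ξ : ℝ) :
    ∫⁻ y, ‖linkDeriv h m y (θ + ξ)‖ₑ ≤
      ENNReal.ofReal (4 * ((1 / 64) ^ m * exp (ξ ^ 2 / 7))) := by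
  have hg : Integrable fun y => (1 / 64) ^ m * exp (ξ ^ 2 / 7) * gaussEnv (y - h (θ + ξ)) :=
    (integrable_gaussEnv.comp_sub_right _).const_mul _
  rw [← ofReal_integral_norm_eq_lintegral_enorm (integrable_linkDeriv B.smooth m _)]
  refine ENNReal.ofReal_le_ofReal ?_
  refine (integral_mono (integrable_linkDeriv B.smooth m _).norm hg fun y => ?_).trans ?_
  · have := B.abs_linkDeriv_le hm hθ ξ y
    rwa [← mul_assoc] at this
  · rw [integral_const_mul, integral_sub_right_eq_self gaussEnv, mul_comm]
    exact mul_le_mul_of_nonneg_right integral_gaussEnv_le (by positivity)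

/-- The `L¹` size of the Taylor remainder of order `2 * j` of `∂_θ^{2k} v`, `k + j = N`. -/
theorem lintegral_linkDeriv_sub_taylor_le (B : LinkBounds h N q L α τ) {k j : ℕ}
    (hkj : k + j = N) {θ : ℝ} (hθ : |θ| ≤ τ / 256) (ξ : ℝ) :
    ∫⁻ y, ‖linkDeriv h (2 * k) y (θ + ξ) - ∑ i ∈ Finset.range (2 * j),
        ξ ^ i / (i.factorial : ℝ) * linkDeriv h (2 * k + i) y θ‖ₑ ≤
      ENNReal.ofReal (4 * (14 ^ N * (1 / 64) ^ (2 * N) * exp (ξ ^ 2 / 4))) := by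
  rcases j with _ | j
  · simp only [mul_zero, Finset.sum_range_zero, sub_zero]
    refine (B.lintegral_linkDeriv_le (by omega) hθ ξ).trans (ENNReal.ofReal_le_ofReal ?_)
    rw [show k = N by omega]
    have h1 : (1 : ℝ) ≤ 14 ^ N := one_le_pow₀ (by norm_num)
    have h2 : exp (ξ ^ 2 / 7) ≤ exp (ξ ^ 2 / 4) := exp_le_exp.mpr (by nlinarith [sq_nonneg ξ])
    have h3 : (0 : ℝ) ≤ (1 / 64) ^ (2 * N) := by positivity
    have h4 : (1 / 64 : ℝ) ^ (2 * N) * exp (ξ ^ 2 / 7) ≤ (1 / 64) ^ (2 * N) * exp (ξ ^ 2 / 4) :=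
      mul_le_mul_of_nonneg_left h2 h3
    have h5 : 0 ≤ (1 / 64 : ℝ) ^ (2 * N) * exp (ξ ^ 2 / 4) := by positivity
    nlinarith
  · set c : ℝ := ξ ^ (2 * j + 2) / ((2 * j + 1).factorial : ℝ) with hc
    have hc0 : 0 ≤ c := div_nonneg (Even.pow_nonneg ⟨j + 1, by ring⟩ ξ) (by positivity)
    have hcle : c ≤ 14 ^ N * exp (ξ ^ 2 / 14) := by
      have h1 : (ξ ^ 2 / 14) ^ (j + 1) / ((j + 1).factorial : ℝ) ≤ exp (ξ ^ 2 / 14) :=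
        Real.pow_div_factorial_le_exp _ (by positivity) _
      have h2 : ((j + 1).factorial : ℝ) ≤ ((2 * j + 1).factorial : ℝ) := by
        exact_mod_cast Nat.factorial_le (by omega)
      have h3 : (14 : ℝ) ^ (j + 1) ≤ 14 ^ N := pow_le_pow_right₀ (by norm_num) (by omega)
      calc c = (ξ ^ 2) ^ (j + 1) / ((2 * j + 1).factorial : ℝ) := by
            rw [hc, ← pow_mul]; rfl
        _ ≤ (ξ ^ 2) ^ (j + 1) / ((j + 1).factorial : ℝ) :=
            div_le_div_of_nonneg_left (by positivity) (by positivity) h2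
        _ = 14 ^ (j + 1) * ((ξ ^ 2 / 14) ^ (j + 1) / ((j + 1).factorial : ℝ)) := by
            rw [div_pow]; field_simp
        _ ≤ 14 ^ N * exp (ξ ^ 2 / 14) := by gcongr
    have hpt : ∀ y, ‖linkDeriv h (2 * k) y (θ + ξ) - ∑ i ∈ Finset.range (2 * (j + 1)),
        ξ ^ i / (i.factorial : ℝ) * linkDeriv h (2 * k + i) y θ‖ₑ ≤
        ∫⁻ r in Set.Ioc (0 : ℝ) 1, ENNReal.ofReal c * ‖linkDeriv h (2 * N) y (θ + r * ξ)‖ₑ := by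
      intro y
      have h1 := sub_taylorSum_eq_integral (V := fun m => linkDeriv h m y)
        (fun m x => hasDerivAt_linkDeriv B.smooth m y x) (2 * k) (2 * j + 1) θ ξ
      rw [show 2 * j + 1 + 1 = 2 * (j + 1) by ring, show 2 * k + (2 * j + 1) + 1 = 2 * N by omega,
        intervalIntegral.integral_of_le zero_le_one] at h1
      rw [h1]
      refine (enorm_integral_le_lintegral_enorm _).trans ?_
      refine setLIntegral_mono' measurableSet_Ioc fun r hr => ?_
      rw [enorm_mul]
      refine mul_le_mul_left ?_ _
      rw [enorm_eq_ofReal_abs]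
      refine ENNReal.ofReal_le_ofReal ?_
      rw [show (1 - r) ^ (2 * j + 1) / ((2 * j + 1).factorial : ℝ) * ξ ^ (2 * (j + 1)) =
        (1 - r) ^ (2 * j + 1) * c by rw [hc]; ring, abs_mul, abs_of_nonneg hc0, abs_pow]
      refine mul_le_of_le_one_left hc0 (pow_le_one₀ (abs_nonneg _) ?_)
      rw [abs_le]
      constructor <;> linarith [hr.1, hr.2]
    refine (lintegral_mono hpt).trans ?_
    have hmeas : Measurable fun p : ℝ × ℝ =>
        ENNReal.ofReal c * ‖linkDeriv h (2 * N) p.1 (θ + p.2 * ξ)‖ₑ := by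
      have h1 : Continuous fun p : ℝ × ℝ => linkDeriv h (2 * N) p.1 (θ + p.2 * ξ) :=
        (continuous_linkDeriv B.smooth (2 * N)).comp
          (continuous_fst.prodMk (continuous_const.add (continuous_snd.mul continuous_const)))
      exact h1.measurable.enorm.const_mul _
    rw [lintegral_lintegral_swap hmeas.aemeasurable]
    have hr : ∀ r ∈ Set.Ioc (0 : ℝ) 1,
        ∫⁻ y, ENNReal.ofReal c * ‖linkDeriv h (2 * N) y (θ + r * ξ)‖ₑ ≤
        ENNReal.ofReal (4 * (14 ^ N * (1 / 64) ^ (2 * N) * exp (ξ ^ 2 / 4))) := by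
      intro r hr
      rw [lintegral_const_mul' _ _ ENNReal.ofReal_ne_top]
      refine (mul_le_mul_right (B.lintegral_linkDeriv_le le_rfl hθ (r * ξ)) _).trans ?_
      rw [← ENNReal.ofReal_mul hc0]
      refine ENNReal.ofReal_le_ofReal ?_
      have h1 : exp ((r * ξ) ^ 2 / 7) ≤ exp (ξ ^ 2 / 7) := by
        refine exp_le_exp.mpr ?_
        rw [mul_pow]
        have : r ^ 2 ≤ 1 := pow_le_one₀ hr.1.le hr.2
        nlinarith [sq_nonneg ξ]
      have h2 : exp (ξ ^ 2 / 14) * exp (ξ ^ 2 / 7) ≤ exp (ξ ^ 2 / 4) := by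
        rw [← exp_add]
        exact exp_le_exp.mpr (by nlinarith [sq_nonneg ξ])
      calc c * (4 * ((1 / 64) ^ (2 * N) * exp ((r * ξ) ^ 2 / 7)))
          ≤ (14 ^ N * exp (ξ ^ 2 / 14)) * (4 * ((1 / 64) ^ (2 * N) * exp (ξ ^ 2 / 7))) := by gcongr
        _ = 4 * (14 ^ N * (1 / 64) ^ (2 * N) * (exp (ξ ^ 2 / 14) * exp (ξ ^ 2 / 7))) := by ring
        _ ≤ _ := by gcongr
    refine (setLIntegral_mono' measurableSet_Ioc hr).trans ?_
    simp

theorem lintegral_signedKernel_sub_taylorPart_le (B : LinkBounds h N q L α τ) {θ : ℝ}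
    (hθ : |θ| ≤ τ / 256) (ξ : ℝ) :
    ∫⁻ y, ‖signedKernel 1 (fun y x => hermiteFun 0 (y - h x)) N y (θ + ξ) -
        taylorPart h N θ y ξ‖ₑ ≤
      ENNReal.ofReal (8 * (14 ^ N * (1 / 64) ^ (2 * N) * exp (ξ ^ 2 / 4))) := by
  set K : ℝ := 14 ^ N * (1 / 64) ^ (2 * N) * exp (ξ ^ 2 / 4) with hK
  have hK0 : 0 ≤ K := by positivity
  have hm : ∀ m x, Measurable fun y => linkDeriv h m y x := fun m x =>
    ((continuous_linkDeriv B.smooth m).comp (continuous_id.prodMk continuous_const)).measurable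
  simp only [signedKernel_sub_taylorPart]
  calc _ ≤ ∫⁻ y, ∑ k ∈ Finset.range (N + 1), ENNReal.ofReal ((1 / 2) ^ k) *
        ‖linkDeriv h (2 * k) y (θ + ξ) - ∑ j ∈ Finset.range (2 * (N - k)),
          ξ ^ j / (j.factorial : ℝ) * linkDeriv h (2 * k + j) y θ‖ₑ := by
        refine lintegral_mono fun y => (enorm_sum_le _ _).trans (Finset.sum_le_sum fun k _ => ?_)
        rw [enorm_mul]
        refine mul_le_mul_left ?_ _
        rw [enorm_eq_ofReal_abs]
        exact ENNReal.ofReal_le_ofReal (abs_kernelCoeff_le k)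
    _ = ∑ k ∈ Finset.range (N + 1), ENNReal.ofReal ((1 / 2) ^ k) *
        ∫⁻ y, ‖linkDeriv h (2 * k) y (θ + ξ) - ∑ j ∈ Finset.range (2 * (N - k)),
          ξ ^ j / (j.factorial : ℝ) * linkDeriv h (2 * k + j) y θ‖ₑ := by
        rw [lintegral_finsetSum _ fun k _ => ?_]
        · exact Finset.sum_congr rfl fun k _ => lintegral_const_mul' _ _ ENNReal.ofReal_ne_top
        · fun_prop
    _ ≤ ∑ k ∈ Finset.range (N + 1), ENNReal.ofReal ((1 / 2) ^ k * (4 * K)) := by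
        refine Finset.sum_le_sum fun k hk => ?_
        rw [Finset.mem_range] at hk
        rw [ENNReal.ofReal_mul (by positivity)]
        exact mul_le_mul_right (B.lintegral_linkDeriv_sub_taylor_le (by omega) hθ ξ) _
    _ = ENNReal.ofReal ((∑ k ∈ Finset.range (N + 1), (1 / 2 : ℝ) ^ k) * (4 * K)) := by
        rw [Finset.sum_mul, ENNReal.ofReal_sum_of_nonneg fun k _ => by positivity]
    _ ≤ _ := by
        refine ENNReal.ofReal_le_ofReal ?_
        nlinarith [sum_half_pow_le (N + 1)]

theorem integral_abs_integral_signedKernel_sub_le (B : LinkBounds h N q L α τ) {θ : ℝ}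
    (hθ : |θ| ≤ τ / 256) :
    ∫ y, |(∫ x, signedKernel 1 (fun y x => hermiteFun 0 (y - h x)) N y x * srcDensity 1 θ x) -
        linkDeriv h 0 y θ| ≤ 12 * (14 ^ N * (1 / 64) ^ (2 * N)) := by
  have hN : 0 < N := by have := B.le_N; omega
  set R : ℝ → ℝ → ℝ := fun y ξ =>
    signedKernel 1 (fun y x => hermiteFun 0 (y - h x)) N y (θ + ξ) - taylorPart h N θ y ξ with hR
  have hRc : Continuous fun p : ℝ × ℝ => R p.1 p.2 * gaussDens p.2 := by
    refine Continuous.mul (Continuous.sub ?_ (continuous_taylorPart B.smooth N θ))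
      (continuous_gaussDens.comp continuous_snd)
    exact (continuous_signedKernel B.smooth N).comp
      (continuous_fst.prodMk (continuous_const.add continuous_snd))
  set K : ℝ := 14 ^ N * (1 / 64) ^ (2 * N) with hK
  have hK0 : 0 ≤ K := by positivity
  have htot : ∫⁻ y, ∫⁻ ξ, ‖R y ξ * gaussDens ξ‖ₑ ≤ ENNReal.ofReal (12 * K) := by
    rw [lintegral_lintegral_swap hRc.measurable.enorm.aemeasurable]
    calc _ ≤ ∫⁻ ξ, ENNReal.ofReal (8 * K * wideDens ξ) := by
          refine lintegral_mono fun ξ => ?_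
          simp only [enorm_mul]
          rw [lintegral_mul_const' _ _ enorm_ne_top]
          refine (mul_le_mul_left (B.lintegral_signedKernel_sub_taylorPart_le hθ ξ) _).trans ?_
          rw [enorm_eq_ofReal (gaussDens_pos ξ).le, ← ENNReal.ofReal_mul (by positivity)]
          refine ENNReal.ofReal_le_ofReal ?_
          have h1 : exp (ξ ^ 2 / 4) * gaussDens ξ ≤ exp 0 * wideDens ξ :=
            gaussDens_mul_exp_le (by linarith)
          rw [exp_zero, one_mul] at h1
          calc _ = 8 * K * (exp (ξ ^ 2 / 4) * gaussDens ξ) := by ring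
            _ ≤ _ := by gcongr
      _ = ENNReal.ofReal (8 * K * √2) := by
          rw [← ofReal_integral_eq_lintegral_ofReal (integrable_wideDens.const_mul _)
            (Eventually.of_forall fun ξ => mul_nonneg (by positivity) (wideDens_nonneg ξ)),
            integral_const_mul, integral_wideDens]
      _ ≤ _ := by
          refine ENNReal.ofReal_le_ofReal ?_
          have h2 : √2 ≤ 1.5 := by
            rw [Real.sqrt_le_left (by norm_num)]; norm_num
          nlinarith
  have hmeas : Measurable fun y => ∫⁻ ξ, ‖R y ξ * gaussDens ξ‖ₑ :=
    hRc.measurable.enorm.lintegral_prod_right'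
  have hae : ∀ᵐ y, ∫⁻ ξ, ‖R y ξ * gaussDens ξ‖ₑ < ∞ :=
    ae_lt_top hmeas (htot.trans_lt ENNReal.ofReal_lt_top).ne
  have heq : ∀ᵐ y, (∫ x, signedKernel 1 (fun y x => hermiteFun 0 (y - h x)) N y x *
      srcDensity 1 θ x) - linkDeriv h 0 y θ = ∫ ξ, R y ξ * gaussDens ξ := by
    filter_upwards [hae] with y hy
    have hRi : Integrable fun ξ => R y ξ * gaussDens ξ :=
      ⟨(hRc.comp (continuous_const.prodMk continuous_id)).aestronglyMeasurable, hy⟩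
    rw [← integral_add_left_eq_self _ θ, ← integral_taylorPart_mul h hN θ y, sub_eq_iff_eq_add,
      ← integral_add hRi (integrable_taylorPart_mul h N θ y)]
    refine integral_congr_ae (Eventually.of_forall fun ξ => ?_)
    simp only [hR, srcDensity_one, add_sub_cancel_left]
    ring
  rw [integral_congr_ae (g := fun y => |∫ ξ, R y ξ * gaussDens ξ|)
    (heq.mono fun y hy => by simp only [hy])]
  by_cases hint : Integrable fun y => ∫ ξ, R y ξ * gaussDens ξ
  · have h1 := ofReal_integral_norm_eq_lintegral_enorm hint
    have h2 : ENNReal.ofReal (∫ y, ‖∫ ξ, R y ξ * gaussDens ξ‖) ≤ ENNReal.ofReal (12 * K) := by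
      rw [h1]
      exact (lintegral_mono fun y => enorm_integral_le_lintegral_enorm _).trans htot
    exact (ENNReal.ofReal_le_ofReal_iff (by positivity)).mp h2
  · rw [integral_undef]
    · positivity
    · contrapose! hint
      have hsm : StronglyMeasurable fun y => ∫ ξ, R y ξ * gaussDens ξ :=
        hRc.stronglyMeasurable.integral_prod_right'
      exact (integrable_norm_iff hsm.aestronglyMeasurable).mp hint

end LinkBounds

theorem le_biSup_of_forall_le {S : Set ℝ} {g : ℝ → ℝ} {M : ℝ} (hM : ∀ x ∈ S, g x ≤ M) {x : ℝ}
    (hx : x ∈ S) : g x ≤ ⨆ x ∈ S, g x := by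
  refine le_ciSup_of_le ⟨max M 0, ?_⟩ x (by rw [ciSup_pos hx])
  rintro _ ⟨z, rfl⟩
  by_cases hz : z ∈ S
  · simp only [ciSup_pos hz]
    exact (hM z hz).trans (le_max_left _ _)
  · have : IsEmpty (z ∈ S) := ⟨hz⟩
    simp only [Real.iSup_of_isEmpty]
    exact le_max_right _ _

theorem abs_le_add_integral_of_hasDerivAt {g g' : ℝ → ℝ} (hg : ∀ x, HasDerivAt g (g' x) x)
    (hc : Continuous g') (hi : Integrable fun s => |g' s| * exp (-s ^ 2 / 2)) (x : ℝ) :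
    |g x| ≤ |g 0| + exp (x ^ 2 / 2) * ∫ s, |g' s| * exp (-s ^ 2 / 2) := by
  have h1 := intervalIntegral.integral_eq_sub_of_hasDerivAt (a := 0) (b := x)
    (fun s _ => hg s) (hc.intervalIntegrable _ _)
  have h2 : |g x - g 0| ≤ exp (x ^ 2 / 2) * ∫ s, |g' s| * exp (-s ^ 2 / 2) := by
    rw [← h1]
    refine (intervalIntegral.norm_integral_le_integral_norm_uIoc (f := g')).trans ?_
    calc ∫ s in Set.uIoc 0 x, ‖g' s‖
        ≤ ∫ s in Set.uIoc 0 x, exp (x ^ 2 / 2) * (|g' s| * exp (-s ^ 2 / 2)) := by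
          refine setIntegral_mono_on ?_ (hi.const_mul _).integrableOn measurableSet_uIoc ?_
          · exact (hc.norm.intervalIntegrable 0 x).def'
          · intro s hs
            rw [Real.norm_eq_abs, mul_left_comm, ← exp_add]
            refine le_mul_of_one_le_right (abs_nonneg _) (one_le_exp ?_)
            have h3 : |s| ≤ |x| := by
              rcases Set.mem_uIoc.mp hs with h | h
              · rw [abs_of_pos h.1]; exact h.2.trans (le_abs_self x)
              · rw [abs_of_nonpos h.2, abs_of_nonpos (by linarith)]; linarith
            have := sq_le_sq.mpr h3
            linarith
      _ ≤ ∫ s, exp (x ^ 2 / 2) * (|g' s| * exp (-s ^ 2 / 2)) :=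
          setIntegral_le_integral (hi.const_mul _) (Eventually.of_forall fun s => by positivity)
      _ = _ := integral_const_mul _ _
  have h3 := abs_sub_abs_le_abs_sub (g x) (g 0)
  linarith

namespace Assumption3

variable {f : ℝ → ℝ} {Cf : ℕ} {Ct : ℝ}

theorem continuous_iteratedDeriv (H : Assumption3 f Cf Ct) (j : ℕ) :
    Continuous (iteratedDeriv j f) :=
  H.smooth.continuous_iteratedDeriv j (by exact_mod_cast le_top)

theorem derivSumF_nonneg (H : Assumption3 f Cf Ct) (n : ℕ) (t : ℝ) : 0 ≤ derivSumF f Ct n t := by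
  have := H.Ct_pos
  exact Finset.sum_nonneg fun j _ => by positivity

theorem abs_iteratedDeriv_le (H : Assumption3 f Cf Ct) {n j : ℕ} (hj : 1 ≤ j) (hjn : j ≤ n)
    (t : ℝ) : |iteratedDeriv j f t| ≤ Ct ^ j * (j.factorial : ℝ) * derivSumF f Ct n t := by
  have hC := H.Ct_pos
  rw [← div_le_iff₀' (by positivity)]
  exact Finset.single_le_sum (f := fun j => |iteratedDeriv j f t| / (Ct ^ j * (j.factorial : ℝ)))
    (fun j _ => by positivity) (Finset.mem_Icc.mpr ⟨hj, hjn⟩)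

theorem integrable_abs_iteratedDeriv_mul_exp (H : Assumption3 f Cf Ct) {j : ℕ} (hj : 1 ≤ j) :
    Integrable fun x => |iteratedDeriv j f (x / 2)| * exp (-x ^ 2 / 2) := by
  have hC := H.Ct_pos
  have h1 := H.bound_int 0 j hj (2 * √2) (by simp)
  have h2 : Integrable fun x : ℝ => exp (-x ^ 2 / 2) / √(2 * π) := by
    refine integrable_gaussDens.congr (Eventually.of_forall fun x => ?_)
    simp only [gaussDens]; ring
  refine ((h1.add h2).const_mul (Ct ^ j * (j.factorial : ℝ) * √(2 * π))).mono' ?_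
    (Eventually.of_forall fun x => ?_)
  · have := H.continuous_iteratedDeriv j
    exact Continuous.aestronglyMeasurable (by fun_prop)
  · have h3 : (0 + √2 * x) / (2 * √2) = x / 2 := by
      rw [zero_add]
      field_simp
    have h4 := H.derivSumF_nonneg j (x / 2)
    have h5 : derivSumF f Ct j (x / 2) ≤ derivSumF f Ct j (x / 2) ^ j + 1 := by
      rcases le_or_gt (derivSumF f Ct j (x / 2)) 1 with h | h
      · linarith [pow_nonneg h4 j]
      · linarith [le_self_pow₀ h.le (by omega : j ≠ 0)]
    simp only [Pi.add_apply, h3]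
    rw [Real.norm_of_nonneg (by positivity)]
    calc |iteratedDeriv j f (x / 2)| * exp (-x ^ 2 / 2)
        ≤ (Ct ^ j * (j.factorial : ℝ) * (derivSumF f Ct j (x / 2) ^ j + 1)) *
          exp (-x ^ 2 / 2) := by
          gcongr
          refine (H.abs_iteratedDeriv_le hj le_rfl _).trans ?_
          gcongr
      _ = _ := by field_simp

theorem exists_abs_iteratedDeriv_le (H : Assumption3 f Cf Ct) (j : ℕ) :
    ∃ K, 0 ≤ K ∧ ∀ t, |iteratedDeriv j f t| ≤ K * exp (2 * t ^ 2) := by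
  have hd : ∀ x, HasDerivAt (fun x => iteratedDeriv j f (x / 2))
      (iteratedDeriv (j + 1) f (x / 2) * (1 / 2)) x := by
    intro x
    have h1 := (H.smooth.differentiable_iteratedDeriv j
      (by exact_mod_cast WithTop.coe_lt_top j)).differentiableAt (x := x / 2) |>.hasDerivAt
    rw [← iteratedDeriv_succ] at h1
    exact h1.comp x ((hasDerivAt_id x).div_const 2)
  have hc : Continuous fun x => iteratedDeriv (j + 1) f (x / 2) * (1 / 2) := by
    have := H.continuous_iteratedDeriv (j + 1)
    fun_prop
  have hi : Integrable fun s =>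
      |iteratedDeriv (j + 1) f (s / 2) * (1 / 2)| * exp (-s ^ 2 / 2) := by
    refine ((H.integrable_abs_iteratedDeriv_mul_exp (Nat.le_add_left 1 j)).const_mul
      (1 / 2)).congr (Eventually.of_forall fun s => ?_)
    simp only [abs_mul]
    rw [abs_of_pos (by norm_num : (0 : ℝ) < 1 / 2)]
    ring
  have hI : 0 ≤ ∫ s, |iteratedDeriv (j + 1) f (s / 2) * (1 / 2)| * exp (-s ^ 2 / 2) :=
    integral_nonneg fun s => by positivity
  refine ⟨_, add_nonneg (abs_nonneg (iteratedDeriv j f (0 / 2))) hI, fun t => ?_⟩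
  have h1 := abs_le_add_integral_of_hasDerivAt hd hc hi (2 * t)
  rw [mul_div_cancel_left₀ t two_ne_zero, show (2 * t) ^ 2 / 2 = 2 * t ^ 2 by ring] at h1
  have h2 : 1 ≤ exp (2 * t ^ 2) := one_le_exp (by positivity)
  nlinarith [abs_nonneg (iteratedDeriv j f (0 / 2))]

theorem exists_derivSumF_le (H : Assumption3 f Cf Ct) (n : ℕ) :
    ∃ K, 0 ≤ K ∧ ∀ t, derivSumF f Ct n t ≤ K * exp (2 * t ^ 2) := by
  have hC := H.Ct_pos
  choose K hK0 hK using H.exists_abs_iteratedDeriv_le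
  refine ⟨∑ j ∈ Finset.Icc 1 n, K j / (Ct ^ j * (j.factorial : ℝ)),
    Finset.sum_nonneg fun j _ => div_nonneg (hK0 j) (by positivity), fun t => ?_⟩
  rw [Finset.sum_mul]
  refine Finset.sum_le_sum fun j _ => ?_
  rw [div_mul_eq_mul_div]
  gcongr
  exact hK j t

theorem derivSumF_le_Lf (H : Assumption3 f Cf Ct) (n : ℕ) {t : ℝ} (ht : |t| ≤ 1) :
    derivSumF f Ct n t ≤ Lf f Ct n := by
  obtain ⟨K, hK0, hK⟩ := H.exists_derivSumF_le n
  refine le_biSup_of_forall_le (S := {x : ℝ | |x| ≤ 1}) (M := K * exp 2) (fun x hx => ?_) ht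
  refine (hK x).trans ?_
  have : x ^ 2 ≤ 1 := (sq_le_one_iff_abs_le_one x).mpr hx
  gcongr
  linarith

theorem derivSumF_le_Ltf (H : Assumption3 f Cf Ct) {n : ℕ} {τ : ℝ}
    (hτ : 2 ≤ τ ^ 2 / (8 * (n : ℝ))) {t : ℝ} (ht : 1 ≤ |t|) :
    derivSumF f Ct n t ≤ Ltf f Ct n τ * exp (τ ^ 2 * t ^ 2 / (8 * (n : ℝ))) := by
  obtain ⟨K, hK0, hK⟩ := H.exists_derivSumF_le n
  have h1 := le_biSup_of_forall_le (S := {x : ℝ | 1 ≤ |x|}) (M := K)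
    (g := fun x => derivSumF f Ct n x * exp (-(τ ^ 2 * x ^ 2) / (8 * (n : ℝ)))) (fun x _ => ?_) ht
  · have h2 := mul_le_mul_of_nonneg_right h1 (exp_pos (τ ^ 2 * t ^ 2 / (8 * (n : ℝ)))).le
    rwa [mul_assoc, ← exp_add, neg_div, neg_add_cancel, exp_zero, mul_one] at h2
  · calc derivSumF f Ct n x * exp (-(τ ^ 2 * x ^ 2) / (8 * (n : ℝ)))
        ≤ K * exp (2 * x ^ 2) * exp (-(τ ^ 2 * x ^ 2) / (8 * (n : ℝ))) := by gcongr; exact hK x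
      _ = K * exp (2 * x ^ 2 + -(τ ^ 2 * x ^ 2) / (8 * (n : ℝ))) := by rw [mul_assoc, exp_add]
      _ ≤ K * 1 := by
          gcongr
          rw [exp_le_one_iff, neg_div, mul_div_right_comm]
          nlinarith [sq_nonneg x]
      _ = K := mul_one K

theorem abs_deriv_div_le (H : Assumption3 f Cf Ct) {t : ℝ} (ht : t ^ 2 ≤ 1 / 8) :
    |iteratedDeriv 1 f t| / Ct ≤ (Cf.factorial : ℝ) := by
  have hC := H.Ct_pos
  have h8 : 2 * √2 * |t| ≤ 1 := by
    refine abs_le_one_iff_mul_self_le_one.mpr ?_ |>.trans' (le_abs_self _)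
    have h2 : √2 * √2 = 2 := Real.mul_self_sqrt (by norm_num)
    have h3 : |t| * |t| = t ^ 2 := by rw [← sq, sq_abs]
    calc 2 * √2 * |t| * (2 * √2 * |t|) = 4 * (√2 * √2) * (|t| * |t|) := by ring
      _ ≤ 1 := by rw [h2, h3]; linarith
  set F : ℕ → ℝ → ℝ := fun k x =>
    |iteratedDeriv 1 f ((((k : ℝ) + 3) * t + √2 * x) / ((k : ℝ) + 3))| / Ct * gaussDens x with hF
  have hF0 : ∀ k x, 0 ≤ F k x := fun k x =>
    mul_nonneg (by positivity) (gaussDens_pos x).le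
  have hFc : ∀ k, Continuous (F k) := fun k => by
    have := H.continuous_iteratedDeriv 1
    have := continuous_gaussDens
    have : (k : ℝ) + 3 ≠ 0 := by positivity
    simp only [hF]
    fun_prop
  have hle : ∀ k, ∫⁻ x, ENNReal.ofReal (F k x) ≤ ENNReal.ofReal (Cf.factorial : ℝ) := by
    intro k
    have hk : (0 : ℝ) < (k : ℝ) + 3 := by positivity
    have hτ : 2 * √2 * max 1 |((k : ℝ) + 3) * t| ≤ (k : ℝ) + 3 := by
      rw [mul_max_of_nonneg _ _ (by positivity), abs_mul, abs_of_pos hk]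
      refine max_le ?_ ?_
      · have h2 : √2 ≤ 1.5 := by
          rw [Real.sqrt_le_left (by norm_num)]; norm_num
        have : (0 : ℝ) ≤ k := k.cast_nonneg
        linarith
      · nlinarith
    have h1 := H.bound_int (((k : ℝ) + 3) * t) 1 le_rfl _ hτ
    have h2 := H.bound_le (((k : ℝ) + 3) * t) 1 le_rfl _ hτ
    have h3 : ∀ x, (derivSumF f Ct 1 ((((k : ℝ) + 3) * t + √2 * x) / ((k : ℝ) + 3))) ^ 1 *
        (exp (-x ^ 2 / 2) / √(2 * π)) = F k x := by
      intro x
      simp only [hF, derivSumF, gaussDens, Finset.Icc_self, Finset.sum_singleton, pow_one,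
        Nat.factorial_one, Nat.cast_one, mul_one]
      ring
    simp only [h3, mul_one] at h1 h2
    rw [← ofReal_integral_eq_lintegral_ofReal h1 (Eventually.of_forall (hF0 k))]
    exact ENNReal.ofReal_le_ofReal h2
  have hlim : ∀ x, Tendsto (fun k => ENNReal.ofReal (F k x)) atTop
      (𝓝 (ENNReal.ofReal (|iteratedDeriv 1 f t| / Ct * gaussDens x))) := by
    intro x
    refine ENNReal.tendsto_ofReal ?_
    refine Tendsto.mul_const _ (Tendsto.div_const ?_ _)
    refine ((H.continuous_iteratedDeriv 1).abs.tendsto t).comp ?_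
    have hk : Tendsto (fun k : ℕ => (k : ℝ) + 3) atTop atTop :=
      tendsto_atTop_add_const_right _ _ tendsto_natCast_atTop_atTop
    have h1 : Tendsto (fun k : ℕ => t + √2 * x / ((k : ℝ) + 3)) atTop (𝓝 (t + 0)) :=
      tendsto_const_nhds.add (tendsto_const_nhds.div_atTop hk)
    rw [add_zero] at h1
    refine h1.congr fun k => ?_
    have : (k : ℝ) + 3 ≠ 0 := by positivity
    field_simp
  have hfatou := lintegral_liminf_le (μ := volume) (u := atTop) (f := fun k x => ENNReal.ofReal (F k x))
    fun k => (hFc k).measurable.ennreal_ofReal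
  simp only [fun x => (hlim x).liminf_eq] at hfatou
  have h1 : ∫⁻ x, ENNReal.ofReal (|iteratedDeriv 1 f t| / Ct * gaussDens x) =
      ENNReal.ofReal (|iteratedDeriv 1 f t| / Ct) := by
    rw [← ofReal_integral_eq_lintegral_ofReal (integrable_gaussDens.const_mul _)
      (Eventually.of_forall fun x => mul_nonneg (by positivity) (gaussDens_pos x).le),
      integral_const_mul, integral_gaussDens, mul_one]
  rw [h1] at hfatou
  refine (ENNReal.ofReal_le_ofReal_iff (by positivity)).mp (hfatou.trans ?_)
  exact (liminf_le_liminf (Eventually.of_forall hle)).trans (le_of_eq (liminf_const _))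

end Assumption3

theorem CbarF_ge (Cf : ℕ) : 180000 * (Cf.factorial : ℝ) ^ 2 ≤ CbarF Cf := by
  have he : 2.7 ≤ exp 1 := by linarith [exp_one_gt_d9]
  have hpi : (3 : ℝ) ≤ π := pi_gt_three.le
  have h1 : (288 : ℝ) ≤ 32 * π ^ 2 := by nlinarith
  have h2 : (625 : ℝ) ≤ (2 * exp 1) ^ (4 * (1 + Cf)) := by
    calc (625 : ℝ) = 5 ^ 4 := by norm_num
      _ ≤ (2 * exp 1) ^ 4 := by gcongr; linarith
      _ ≤ _ := pow_le_pow_right₀ (by linarith) (by omega)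
  have h3 : (Cf.factorial : ℝ) ^ 2 ≤ exp 1 ^ (4 * (1 + Cf) ^ 2) := by
    have h4 : (Cf.factorial : ℝ) ≤ exp 1 ^ (Cf * Cf) := by
      calc (Cf.factorial : ℝ) ≤ (Cf : ℝ) ^ Cf := by exact_mod_cast Nat.factorial_le_pow Cf
        _ ≤ (exp 1 ^ Cf) ^ Cf := by
          gcongr
          rw [← exp_nat_mul, mul_one]
          linarith [add_one_le_exp (Cf : ℝ)]
        _ = _ := (pow_mul _ _ _).symm
    calc (Cf.factorial : ℝ) ^ 2 ≤ (exp 1 ^ (Cf * Cf)) ^ 2 := by gcongr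
      _ = exp 1 ^ (Cf * Cf * 2) := (pow_mul _ _ _).symm
      _ ≤ _ := pow_le_pow_right₀ (by linarith) (by nlinarith)
  unfold CbarF
  calc 180000 * (Cf.factorial : ℝ) ^ 2 = 288 * 625 * (Cf.factorial : ℝ) ^ 2 := by norm_num
    _ ≤ _ := by gcongr

theorem CbarF_mul_exp_ge (Cf N : ℕ) (hN : 1 ≤ N) :
    6 * (14 ^ N * (1 / 64 : ℝ) ^ (2 * N)) ≤ CbarF Cf * exp (-((2 * exp 1)⁻¹ *
      (2 * (N : ℝ) + 1) ^ ((1 : ℝ) / (2 * (1 + (Cf : ℝ)))))) := by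
  have hN' : (1 : ℝ) ≤ N := by exact_mod_cast hN
  have he : 2.7 ≤ exp 1 := by linarith [exp_one_gt_d9]
  have hC : 6 ≤ CbarF Cf := by
    have h1 : (1 : ℝ) ≤ Cf.factorial := by exact_mod_cast Cf.factorial_pos
    nlinarith [CbarF_ge Cf]
  have hrpow : (2 * (N : ℝ) + 1) ^ ((1 : ℝ) / (2 * (1 + (Cf : ℝ)))) ≤ 2 * (N : ℝ) + 1 := by
    refine rpow_le_self_of_one_le (by linarith) ?_
    rw [div_le_one (by positivity)]
    have : (0 : ℝ) ≤ Cf := Cf.cast_nonneg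
    linarith
  have hinv : (2 * exp 1)⁻¹ ≤ 1 / 5 := by
    rw [inv_eq_one_div]
    exact one_div_le_one_div_of_le (by norm_num) (by linarith)
  have hexp : (2 * exp 1)⁻¹ * (2 * (N : ℝ) + 1) ^ ((1 : ℝ) / (2 * (1 + (Cf : ℝ)))) ≤ N := by
    calc _ ≤ 1 / 5 * (2 * (N : ℝ) + 1) := by gcongr
      _ ≤ N := by linarith
  have hpow : 14 ^ N * (1 / 64 : ℝ) ^ (2 * N) ≤ exp (-N) := by
    rw [pow_mul, ← mul_pow, show -(N : ℝ) = N * (-1) by ring, exp_nat_mul]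
    refine pow_le_pow_left₀ (by norm_num) ?_ _
    have h1 : exp 1 ≤ 3 := by linarith [exp_one_lt_d9]
    calc (14 * (1 / 64) ^ 2 : ℝ) ≤ 1 / 3 := by norm_num
      _ ≤ 1 / exp 1 := one_div_le_one_div_of_le (exp_pos 1) h1
      _ = exp (-1) := by rw [exp_neg, one_div]
  have h2 : exp (-(N : ℝ)) ≤ exp (-((2 * exp 1)⁻¹ *
      (2 * (N : ℝ) + 1) ^ ((1 : ℝ) / (2 * (1 + (Cf : ℝ)))))) := exp_le_exp.mpr (by linarith)
  exact mul_le_mul hC (hpow.trans h2) (by positivity) (by linarith)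

theorem abs_iteratedDeriv_comp_div {f : ℝ → ℝ} (hf : ContDiff ℝ (⊤ : ℕ∞) f) {τ : ℝ} (hτ : 0 < τ)
    (Ct : ℝ) (i : ℕ) (x c : ℝ) :
    |iteratedDeriv i (fun θ => f (θ / τ)) x| / ((Ct / τ) ^ i * c) =
      |iteratedDeriv i f (x / τ)| / (Ct ^ i * c) := by
  have h1 : iteratedDeriv i (fun θ => f (θ / τ)) x = τ⁻¹ ^ i * iteratedDeriv i f (τ⁻¹ * x) := by
    have := iteratedDeriv_comp_const_mul (n := i) (hf.of_le (by exact_mod_cast le_top)) τ⁻¹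
    simp only [div_eq_inv_mul, this]
  rw [h1, abs_mul, abs_pow, abs_of_pos (inv_pos.mpr hτ), div_pow, ← div_eq_inv_mul, inv_pow]
  field_simp

theorem Assumption3.linkBounds {f : ℝ → ℝ} {Cf : ℕ} {Ct τ : ℝ} {N : ℕ}
    (H : Assumption3 f Cf Ct) (hτ : 0 < τ) (hN : CbarF Cf ≤ 2 * (N : ℝ) + 1)
    (hle : 256 * ((max Ct 1) ^ 2 * max (Lf f Ct (2 * N)) (max (Ltf f Ct (2 * N) τ) 1) * N) ≤ τ) :
    LinkBounds (fun θ => f (θ / τ)) N (Ct / τ)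
      (max (Lf f Ct (2 * N)) (max (Ltf f Ct (2 * N) τ) 1)) (Cf.factorial : ℝ) τ := by
  set L := max (Lf f Ct (2 * N)) (max (Ltf f Ct (2 * N) τ) 1) with hL
  have hC := H.Ct_pos
  have hL1 : 1 ≤ L := (le_max_right _ _).trans (le_max_right _ _)
  have hM1 : 1 ≤ max Ct 1 := le_max_right _ _
  have hCM : Ct ≤ max Ct 1 := le_max_left _ _
  have hα : (1 : ℝ) ≤ Cf.factorial := by exact_mod_cast Cf.factorial_pos
  have hNα : 180000 * (Cf.factorial : ℝ) ^ 2 ≤ 2 * (N : ℝ) + 1 := (CbarF_ge Cf).trans hN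
  have hN1 : (1000 : ℝ) ≤ N := by nlinarith
  have hαN : ((Cf.factorial : ℝ) + 1) ^ 2 ≤ N := by nlinarith
  have hML : 1 ≤ (max Ct 1) ^ 2 * L := one_le_mul_of_one_le_of_one_le (one_le_pow₀ hM1) hL1
  have h256 : 256 * (N : ℝ) ≤ τ := by nlinarith
  have hsum : ∀ x, ∑ i ∈ Finset.Icc 1 (2 * N),
      |iteratedDeriv i (fun θ => f (θ / τ)) x| / ((Ct / τ) ^ i * (i.factorial : ℝ)) =
      derivSumF f Ct (2 * N) (x / τ) := fun x =>
    Finset.sum_congr rfl fun i _ => abs_iteratedDeriv_comp_div H.smooth hτ Ct i x _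
  refine ⟨H.smooth.comp (contDiff_id.div_const τ), by positivity, hL1, by positivity, ?_, ?_, ?_,
    ?_, ?_, by exact_mod_cast hN1, by linarith⟩
  · intro x hx
    rw [hsum]
    refine (H.derivSumF_le_Lf _ ?_).trans (le_max_left _ _)
    rwa [abs_div, abs_of_pos hτ, div_le_one hτ]
  · intro x hx
    rw [hsum]
    have h1 : 1 ≤ |x / τ| := by rwa [abs_div, abs_of_pos hτ, one_le_div hτ]
    have h2 : 2 ≤ τ ^ 2 / (8 * ((2 * N : ℕ) : ℝ)) := by
      rw [le_div_iff₀ (by push_cast; positivity)]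
      push_cast
      nlinarith
    have h3 : Ltf f Ct (2 * N) τ ≤ L := (le_max_left _ _).trans (le_max_right _ _)
    refine (H.derivSumF_le_Ltf h2 h1).trans (le_of_le_of_eq
      (mul_le_mul_of_nonneg_right h3 (exp_pos _).le) ?_)
    congr 2
    push_cast
    field_simp
    ring
  · intro x hx
    have h1 := abs_iteratedDeriv_comp_div H.smooth hτ Ct 1 x 1
    rw [pow_one, pow_one, mul_one, mul_one] at h1
    rw [h1]
    refine H.abs_deriv_div_le ?_
    rw [div_pow, div_le_iff₀ (by positivity)]
    linarith
  · have h1 : Ct * L * N ≤ (max Ct 1) ^ 2 * L * N := by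
      gcongr
      nlinarith
    rw [show 256 * (Ct / τ) * L * N = 256 * (Ct * L * N) / τ by ring, div_le_one hτ]
    linarith
  · have h1 : 2 * Ct * (Cf.factorial + 1) ≤ √τ := by
      refine Real.le_sqrt_of_sq_le ?_
      calc (2 * Ct * ((Cf.factorial : ℝ) + 1)) ^ 2
          = 4 * (Ct ^ 2 * ((Cf.factorial : ℝ) + 1) ^ 2) := by ring
        _ ≤ 4 * ((max Ct 1) ^ 2 * N) := by gcongr
        _ ≤ 256 * ((max Ct 1) ^ 2 * L * N) := by
          have h2 : 0 ≤ (max Ct 1) ^ 2 * (N : ℝ) := by positivity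
          nlinarith
        _ ≤ τ := hle
    have h2 : √τ * √τ = τ := Real.mul_self_sqrt hτ.le
    rw [show 2 * (Ct / τ) * √τ * ((Cf.factorial : ℝ) + 1) =
      (2 * Ct * (Cf.factorial + 1)) * √τ / τ by ring, div_le_one hτ]
    nlinarith [Real.sqrt_nonneg τ]

/-- Lemma 6: (a) signed-kernel deficiency bound and
(b) normalization discrepancy bound, for the Gaussian link target. -/
theorem link_signed_and_pq_bounds :
    ∃ C : ℝ, 0 < C ∧
      ∀ (f : ℝ → ℝ) (Cf : ℕ) (Ct : ℝ) (Θ : Set ℝ) (τ : ℝ) (N : ℕ),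
        Assumption3 f Cf Ct →
        BddAbove ((fun θ : ℝ => θ^2) '' Θ) →
        0 < τ →
        CbarF Cf ≤ 2 * (N:ℝ) + 1 →
        C * max ((max Ct 1)^4 *
              (max (Lf f Ct (2*N)) (max (Ltf f Ct (2*N) τ) 1))^2 * (N:ℝ)^2)
            (⨆ θ ∈ Θ, θ^2) ≤ τ^2 →
        (∀ θ ∈ Θ,
          (1/2) * ∫ y : ℝ,
              |(∫ x : ℝ, signedKernel 1 (linkDensity f τ) N y x * srcDensity 1 θ x)
                - linkDensity f τ y θ|
            ≤ CbarF Cf *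
                Real.exp (-((2 * Real.exp 1)⁻¹ *
                  (2*(N:ℝ)+1) ^ ((1:ℝ)/(2*(1+(Cf:ℝ))))))) ∧
        (∀ θ ∈ Θ,
          (1/2) * ∫ x : ℝ,
              (|pFun 1 (linkDensity f τ) N x - 1| + qFun 1 (linkDensity f τ) N x)
                * srcDensity 1 θ x
            ≤ 12 * Real.exp (-τ/8)
              + 15 * (⨆ θ' ∈ Θ, Real.exp (θ'^2/2 - τ^2/8))) := by
  refine ⟨65536, by norm_num, fun f Cf Ct Θ τ N H hΘ hτ hN hmax => ?_⟩
  have hle : 256 * ((max Ct 1) ^ 2 *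
      max (Lf f Ct (2 * N)) (max (Ltf f Ct (2 * N) τ) 1) * N) ≤ τ := by
    refine (sq_le_sq₀ (by positivity) hτ.le).mp ?_
    refine le_trans (le_of_eq ?_)
      ((mul_le_mul_of_nonneg_left (le_max_left _ _) (by norm_num)).trans hmax)
    ring
  have hθ : ∀ θ ∈ Θ, |θ| ≤ τ / 256 := by
    intro θ hθ
    obtain ⟨M, hM⟩ := hΘ
    have h1 : θ ^ 2 ≤ ⨆ θ ∈ Θ, θ ^ 2 :=
      le_biSup_of_forall_le (fun x hx => hM ⟨x, hx, rfl⟩) hθ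
    have h2 := (mul_le_mul_of_nonneg_left (h1.trans (le_max_right _ _))
      (by norm_num)).trans hmax
    refine abs_le_of_sq_le_sq ?_ (by positivity)
    linarith
  have B := H.linkBounds hτ hN hle
  rw [linkDensity_eq]
  refine ⟨fun θ hmem => ?_, fun θ hmem => ?_⟩
  · have h1 := B.integral_abs_integral_signedKernel_sub_le (hθ θ hmem)
    simp only [linkDeriv_zero, ← hermiteFun_zero] at h1
    have h2 := CbarF_mul_exp_ge Cf N (by have := B.le_N; omega)
    linarith
  · have h1 := B.half_integral_le (hθ θ hmem)
    have h2 : 0 ≤ ⨆ θ' ∈ Θ, exp (θ' ^ 2 / 2 - τ ^ 2 / 8) :=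
      Real.iSup_nonneg fun θ' => Real.iSup_nonneg fun _ => (exp_pos _).le
    linarith
end

section
/- Let B ≥ 1 be an integer and f(θ) = θ^B. Then: (i) f satisfies Assumption 3 with constants C_f = 2B+1 and C̃_f = 4eB, i.e. for all θ ∈ ℝ, all integers n ≥ 1 and all τ ≥ 2√2·max(1,|θ|), ∫_ℝ (Σ_{j=1}^{n} |f^{(j)}((θ+√2·x)/τ)|/((4eB)^j·j!))^n·(e^{−x²/2}/√(2π)) dx ≤ ((2B+1)·n)!; (ii) with C̃_f = 4eB, L_f(n) ≤ 1 for every integer n ≥ 1; and (iii) with C̃_f = 4eB, L̃_f(n,τ) ≤ 1 for every integer n ≥ 1 and every τ with τ² ≥ 8nB. -/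
open MeasureTheory Real Filter

/-- Each weighted derivative of `θ ↦ θ ^ B` decays geometrically in the order. -/
lemma abs_iteratedDeriv_pow_div_le {B : ℕ} (hB : 1 ≤ B) {j : ℕ} (hj : 1 ≤ j) {t M : ℝ}
    (hM : 1 ≤ M) (ht : |t| ≤ M) :
    |iteratedDeriv j (fun θ : ℝ => θ ^ B) t| /
      ((4 * Real.exp 1 * (B : ℝ)) ^ j * (Nat.factorial j : ℝ)) ≤ (1 / 3) ^ j * M ^ (B - 1) := by
  have hB' : (1 : ℝ) ≤ B := by exact_mod_cast hB
  have he : (2 : ℝ) ≤ Real.exp 1 := by linarith [Real.add_one_le_exp (1 : ℝ)]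
  have hj' : (1 : ℝ) ≤ Nat.factorial j := by exact_mod_cast Nat.factorial_pos j
  have hderiv : |iteratedDeriv j (fun θ : ℝ => θ ^ B) t| ≤ (B : ℝ) ^ j * M ^ (B - 1) := by
    have h : iteratedDeriv j (fun θ : ℝ => θ ^ B) t = (B.descFactorial j : ℝ) * t ^ (B - j) := by
      simp
    rw [h, abs_mul, abs_pow, Nat.abs_cast]
    have hd : (B.descFactorial j : ℝ) ≤ (B : ℝ) ^ j := by
      exact_mod_cast Nat.descFactorial_le_pow B j
    have hp : |t| ^ (B - j) ≤ M ^ (B - 1) :=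
      (pow_le_pow_left₀ (abs_nonneg t) ht _).trans (pow_le_pow_right₀ hM (by omega))
    gcongr
  rw [div_le_iff₀ (by positivity)]
  calc |iteratedDeriv j (fun θ : ℝ => θ ^ B) t|
      ≤ (B : ℝ) ^ j * M ^ (B - 1) := hderiv
    _ ≤ ((1 / 3) * (4 * Real.exp 1 * B)) ^ j * M ^ (B - 1) * Nat.factorial j := by
        refine le_trans ?_ (le_mul_of_one_le_right (by positivity) hj')
        gcongr
        nlinarith
    _ = (1 / 3) ^ j * M ^ (B - 1) * ((4 * Real.exp 1 * (B : ℝ)) ^ j * Nat.factorial j) := by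
        rw [mul_pow]; ring

lemma sum_Icc_one_third_pow_le (n : ℕ) : ∑ j ∈ Finset.Icc 1 n, (1 / 3 : ℝ) ^ j ≤ 1 / 2 := by
  have h : ∑ j ∈ Finset.Icc 1 n, (1 / 3 : ℝ) ^ j = 1 / 2 - (1 / 2) * (1 / 3) ^ n := by
    induction n with
    | zero => simp
    | succ n ih => rw [Finset.sum_Icc_succ_top (by omega), ih]; ring
  rw [h]
  have : (0 : ℝ) ≤ (1 / 3) ^ n := by positivity
  linarith

lemma derivSumF_pow_le {B : ℕ} (hB : 1 ≤ B) (n : ℕ) {t M : ℝ} (hM : 1 ≤ M) (ht : |t| ≤ M) :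
    derivSumF (fun θ : ℝ => θ ^ B) (4 * Real.exp 1 * (B : ℝ)) n t ≤ 1 / 2 * M ^ (B - 1) := by
  unfold derivSumF
  calc _ ≤ ∑ j ∈ Finset.Icc 1 n, (1 / 3 : ℝ) ^ j * M ^ (B - 1) :=
        Finset.sum_le_sum fun j hj =>
          abs_iteratedDeriv_pow_div_le hB (Finset.mem_Icc.mp hj).1 hM ht
    _ = (∑ j ∈ Finset.Icc 1 n, (1 / 3 : ℝ) ^ j) * M ^ (B - 1) := by rw [Finset.sum_mul]
    _ ≤ _ := by gcongr; exact sum_Icc_one_third_pow_le n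

lemma derivSumF_nonneg (f : ℝ → ℝ) {Ct : ℝ} (hCt : 0 ≤ Ct) (n : ℕ) (t : ℝ) :
    0 ≤ derivSumF f Ct n t :=
  Finset.sum_nonneg fun _ _ => by positivity

lemma continuous_derivSumF {f : ℝ → ℝ} (hf : ContDiff ℝ (⊤ : ℕ∞) f) (Ct : ℝ) (n : ℕ) :
    Continuous (derivSumF f Ct n) := by
  unfold derivSumF
  refine continuous_finsetSum _ fun j _ => ?_
  exact (hf.continuous_iteratedDeriv j (by exact_mod_cast le_top)).abs.div_const _

lemma abs_link_argument_le {θ τ : ℝ} (hτ : 2 * Real.sqrt 2 * max 1 |θ| ≤ τ) (x : ℝ) :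
    |(θ + Real.sqrt 2 * x) / τ| ≤ 1 + |x| / 2 := by
  have h2 : 0 < Real.sqrt 2 := by positivity
  have h1 : (1 : ℝ) ≤ Real.sqrt 2 := Real.one_le_sqrt.mpr (by norm_num)
  have hθ := le_max_right 1 |θ|
  have hm := le_max_left 1 |θ|
  have hτ1 : 2 * Real.sqrt 2 ≤ τ := by nlinarith
  have hτ2 : |θ| ≤ τ := by nlinarith
  have hτ0 : 0 < τ := by linarith
  rw [abs_div, abs_of_pos hτ0, div_le_iff₀ hτ0]
  calc |θ + Real.sqrt 2 * x| ≤ |θ| + |Real.sqrt 2 * x| := abs_add_le _ _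
    _ = |θ| + Real.sqrt 2 * |x| := by rw [abs_mul, abs_of_pos h2]
    _ ≤ (1 + |x| / 2) * τ := by nlinarith [abs_nonneg x]

/-- A polynomial bound of degree `m` costs at most a factorial times half the Gaussian exponent. -/
lemma one_add_abs_pow_le (m : ℕ) (x : ℝ) :
    (1 + |x| / 2) ^ m ≤ (Nat.factorial m : ℝ) * (Real.exp (5 / 4) * Real.exp (x ^ 2 / 4)) := by
  have h := Real.pow_div_factorial_le_exp (1 + |x| / 2) (by positivity) m
  rw [div_le_iff₀ (by positivity)] at h
  have h' : Real.exp (1 + |x| / 2) ≤ Real.exp (5 / 4) * Real.exp (x ^ 2 / 4) := by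
    rw [← Real.exp_add, Real.exp_le_exp]
    nlinarith [sq_nonneg (|x| - 1), sq_abs x]
  calc _ ≤ Real.exp (1 + |x| / 2) * Nat.factorial m := h
    _ ≤ (Real.exp (5 / 4) * Real.exp (x ^ 2 / 4)) * Nat.factorial m := by gcongr
    _ = _ := by ring

lemma derivSumF_pow_integrand_le {B : ℕ} (hB : 1 ≤ B) {n : ℕ} (hn : 1 ≤ n) {θ τ : ℝ}
    (hτ : 2 * Real.sqrt 2 * max 1 |θ| ≤ τ) (x : ℝ) :
    (derivSumF (fun θ : ℝ => θ ^ B) (4 * Real.exp 1 * (B : ℝ)) n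
        ((θ + Real.sqrt 2 * x) / τ)) ^ n * (Real.exp (-x ^ 2 / 2) / Real.sqrt (2 * Real.pi)) ≤
      (1 / 2 * Nat.factorial ((B - 1) * n) * Real.exp (5 / 4) / Real.sqrt (2 * Real.pi)) *
        Real.exp (-(1 / 4) * x ^ 2) := by
  have hM : 1 ≤ 1 + |x| / 2 := by linarith [abs_nonneg x]
  have hD := derivSumF_pow_le hB n hM (abs_link_argument_le hτ x)
  have h0 := derivSumF_nonneg (fun θ : ℝ => θ ^ B) (Ct := 4 * Real.exp 1 * (B : ℝ))
    (by positivity) n ((θ + Real.sqrt 2 * x) / τ)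
  have hexp : Real.exp (-(1 / 4) * x ^ 2) = Real.exp (x ^ 2 / 4) * Real.exp (-x ^ 2 / 2) := by
    rw [← Real.exp_add]; congr 1; ring
  have hhalf : (1 / 2 : ℝ) ^ n ≤ 1 / 2 :=
    pow_le_of_le_one (by norm_num) (by norm_num) (by omega)
  calc _ ≤ (1 / 2 * (1 + |x| / 2) ^ (B - 1)) ^ n *
          (Real.exp (-x ^ 2 / 2) / Real.sqrt (2 * Real.pi)) := by gcongr
    _ = (1 / 2) ^ n * (1 + |x| / 2) ^ ((B - 1) * n) *
          (Real.exp (-x ^ 2 / 2) / Real.sqrt (2 * Real.pi)) := by rw [mul_pow, ← pow_mul]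
    _ ≤ 1 / 2 * ((Nat.factorial ((B - 1) * n) : ℝ) *
          (Real.exp (5 / 4) * Real.exp (x ^ 2 / 4))) *
          (Real.exp (-x ^ 2 / 2) / Real.sqrt (2 * Real.pi)) := by
        gcongr
        exact one_add_abs_pow_le _ x
    _ = _ := by rw [hexp]; ring

lemma integrable_derivSumF_pow {B : ℕ} (hB : 1 ≤ B) {n : ℕ} (hn : 1 ≤ n) {θ τ : ℝ}
    (hτ : 2 * Real.sqrt 2 * max 1 |θ| ≤ τ) :
    Integrable (fun x : ℝ =>
      (derivSumF (fun θ : ℝ => θ ^ B) (4 * Real.exp 1 * (B : ℝ)) n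
        ((θ + Real.sqrt 2 * x) / τ)) ^ n *
          (Real.exp (-x ^ 2 / 2) / Real.sqrt (2 * Real.pi))) := by
  refine ((integrable_exp_neg_mul_sq (b := 1 / 4) (by norm_num)).const_mul
    (1 / 2 * Nat.factorial ((B - 1) * n) * Real.exp (5 / 4) / Real.sqrt (2 * Real.pi))).mono'
    ?_ (.of_forall fun x => ?_)
  · have hc := continuous_derivSumF (f := fun θ : ℝ => θ ^ B) (by fun_prop)
      (4 * Real.exp 1 * (B : ℝ)) n
    have : Continuous fun x : ℝ => (θ + Real.sqrt 2 * x) / τ := by fun_prop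
    exact (((hc.comp this).pow n).mul (by fun_prop)).aestronglyMeasurable
  · have h0 := derivSumF_nonneg (fun θ : ℝ => θ ^ B) (Ct := 4 * Real.exp 1 * (B : ℝ))
      (by positivity) n ((θ + Real.sqrt 2 * x) / τ)
    rw [Real.norm_of_nonneg (by positivity)]
    exact derivSumF_pow_integrand_le hB hn hτ x

lemma six_mul_factorial_le {B n : ℕ} (hB : 1 ≤ B) (hn : 1 ≤ n) :
    6 * Nat.factorial ((B - 1) * n) ≤ Nat.factorial ((2 * B + 1) * n) := by
  obtain ⟨b, rfl⟩ := Nat.exists_eq_add_of_le' hB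
  rw [Nat.add_sub_cancel]
  calc 6 * Nat.factorial (b * n) = Nat.factorial 3 * Nat.factorial (b * n) := rfl
    _ ≤ Nat.factorial (3 + b * n) :=
        Nat.le_of_dvd (Nat.factorial_pos _) (Nat.factorial_mul_factorial_dvd_factorial_add _ _)
    _ ≤ _ := Nat.factorial_le (by nlinarith [Nat.zero_le (b * n)])

lemma integral_derivSumF_pow_le {B : ℕ} (hB : 1 ≤ B) {n : ℕ} (hn : 1 ≤ n) {θ τ : ℝ}
    (hτ : 2 * Real.sqrt 2 * max 1 |θ| ≤ τ) :
    ∫ x : ℝ, (derivSumF (fun θ : ℝ => θ ^ B) (4 * Real.exp 1 * (B : ℝ)) n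
        ((θ + Real.sqrt 2 * x) / τ)) ^ n *
          (Real.exp (-x ^ 2 / 2) / Real.sqrt (2 * Real.pi)) ≤
      (Nat.factorial ((2 * B + 1) * n) : ℝ) := by
  have hfac : (6 : ℝ) * Nat.factorial ((B - 1) * n) ≤ Nat.factorial ((2 * B + 1) * n) := by
    exact_mod_cast six_mul_factorial_le hB hn
  have hpi : Real.sqrt (Real.pi / (1 / 4)) = Real.sqrt 2 * Real.sqrt (2 * Real.pi) := by
    rw [← Real.sqrt_mul (by norm_num)]; congr 1; ring
  have h2 : Real.sqrt 2 ≤ 3 / 2 := Real.sqrt_le_iff.mpr (by norm_num)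
  have he : Real.exp (5 / 4) ≤ 8 := by
    calc Real.exp (5 / 4) ≤ Real.exp 2 := Real.exp_le_exp.mpr (by norm_num)
      _ = Real.exp 1 * Real.exp 1 := by rw [← Real.exp_add]; norm_num
      _ ≤ 8 := by nlinarith [Real.exp_one_lt_d9, Real.exp_pos 1]
  have hs : Real.sqrt (2 * Real.pi) ≠ 0 := by positivity
  calc _ ≤ ∫ x : ℝ, (1 / 2 * Nat.factorial ((B - 1) * n) * Real.exp (5 / 4) /
            Real.sqrt (2 * Real.pi)) * Real.exp (-(1 / 4) * x ^ 2) :=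
        integral_mono (integrable_derivSumF_pow hB hn hτ)
          ((integrable_exp_neg_mul_sq (by norm_num)).const_mul _)
          (derivSumF_pow_integrand_le hB hn hτ)
    _ = 1 / 2 * Nat.factorial ((B - 1) * n) * (Real.exp (5 / 4) * Real.sqrt 2) := by
        rw [integral_const_mul, integral_gaussian, hpi]
        field_simp
    _ ≤ 1 / 2 * Nat.factorial ((B - 1) * n) * (8 * (3 / 2)) := by gcongr
    _ = 6 * Nat.factorial ((B - 1) * n) := by ring
    _ ≤ _ := hfac

lemma derivSumF_pow_mul_exp_le_one {B : ℕ} (hB : 1 ≤ B) {n : ℕ} (hn : 1 ≤ n) {τ x : ℝ}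
    (hτ : 8 * (n : ℝ) * (B : ℝ) ≤ τ ^ 2) (hx : 1 ≤ |x|) :
    derivSumF (fun θ : ℝ => θ ^ B) (4 * Real.exp 1 * (B : ℝ)) n x *
      Real.exp (-(τ ^ 2 * x ^ 2) / (8 * (n : ℝ))) ≤ 1 := by
  have hn' : (0 : ℝ) < n := by exact_mod_cast hn
  have hexp : Real.exp (-(τ ^ 2 * x ^ 2) / (8 * (n : ℝ))) ≤ Real.exp (-(B * x ^ 2)) := by
    rw [Real.exp_le_exp, div_le_iff₀ (by positivity)]
    nlinarith [mul_le_mul_of_nonneg_right hτ (sq_nonneg x)]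
  have hpow : |x| ^ (B - 1) ≤ Real.exp (B * x ^ 2) := by
    have h : |x| ≤ Real.exp (x ^ 2) := by
      nlinarith [Real.add_one_le_exp (x ^ 2), sq_abs x]
    calc |x| ^ (B - 1) ≤ |x| ^ B := pow_le_pow_right₀ hx (by omega)
      _ ≤ Real.exp (x ^ 2) ^ B := by gcongr
      _ = Real.exp (B * x ^ 2) := (Real.exp_nat_mul _ _).symm
  calc _ ≤ (1 / 2 * Real.exp (B * x ^ 2)) * Real.exp (-(B * x ^ 2)) := by
        refine mul_le_mul ?_ hexp (by positivity) (by positivity)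
        exact (derivSumF_pow_le hB n hx le_rfl).trans (by gcongr)
    _ = 1 / 2 := by rw [mul_assoc, ← Real.exp_add]; simp
    _ ≤ 1 := by norm_num

/-- Corollary 4: the monomial link `f(θ) = θ^B` satisfies
Assumption 3 with `Cf = 2B+1`, `C̃f = 4eB`, and one has `L_f(n) ≤ 1` and,
for `τ² ≥ 8nB`, `L̃_f(n,τ) ≤ 1`. -/
theorem monomial_link
    (B : ℕ) (hB : 1 ≤ B) :
    Assumption3 (fun θ : ℝ => θ^B) (2*B+1) (4 * Real.exp 1 * (B:ℝ)) ∧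
    (∀ n : ℕ, 1 ≤ n → Lf (fun θ : ℝ => θ^B) (4 * Real.exp 1 * (B:ℝ)) n ≤ 1) ∧
    (∀ n : ℕ, 1 ≤ n → ∀ τ : ℝ, 8 * (n:ℝ) * (B:ℝ) ≤ τ^2 →
      Ltf (fun θ : ℝ => θ^B) (4 * Real.exp 1 * (B:ℝ)) n τ ≤ 1) := by
  refine ⟨⟨?_, by fun_prop, fun θ n hn τ hτ => integrable_derivSumF_pow hB hn hτ,
    fun θ n hn τ hτ => integral_derivSumF_pow_le hB hn hτ⟩, fun n _ => ?_, fun n hn τ hτ => ?_⟩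
  · have : (0 : ℝ) < B := by exact_mod_cast hB
    positivity
  · refine Real.iSup_le (fun x => Real.iSup_le (fun hx => ?_) zero_le_one) zero_le_one
    exact (derivSumF_pow_le hB n le_rfl hx).trans (by rw [one_pow]; norm_num)
  · refine Real.iSup_le (fun x => Real.iSup_le (fun hx => ?_) zero_le_one) zero_le_one
    exact derivSumF_pow_mul_exp_le_one hB hn hτ hx
end

section
/- Let τ > 0 and let Z and G be independent standard Gaussian random variables. For θ ∈ [−1,1], let μ_θ be the law of (θ + Z)²/τ² + G (the plug-in output) and let ν_θ be the Gaussian law N(θ²/τ², 1). Then the worst-case total variation distance satisfies sup_{θ ∈ [−1,1]} d_TV(μ_θ, ν_θ) ≥ ((√2 − 1)·e^{−3/2}/(2π))·min(1, 1/τ²). In particular, already for θ = 0 one has 1/2 − P(Z²/τ² + G ≤ 0) ≥ ((√2 − 1)·e^{−3/2}/(2π))·min(1, 1/τ²). -/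
open MeasureTheory Real ProbabilityTheory

/-- The law of a pair of independent standard Gaussian random variables. -/
noncomputable def stdGauss2 : Measure (ℝ × ℝ) :=
  (gaussianReal 0 1).prod (gaussianReal 0 1)

/-- The law of the plug-in output `(θ + Z)²/τ² + G` with `Z, G` independent
standard Gaussians. -/
noncomputable def pluginLaw (τ θ : ℝ) : Measure ℝ :=
  stdGauss2.map (fun p : ℝ × ℝ => (θ + p.1)^2 / τ^2 + p.2)

/-- The total variation distance `sup_{A Borel} |μ(A) − ν(A)|`. -/
noncomputable def tvDist (μ ν : Measure ℝ) : ℝ :=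
  ⨆ A : {A : Set ℝ // MeasurableSet A}, |(μ A.1).toReal - (ν A.1).toReal|

lemma gaussianReal_real_Ioc_ge {a b c : ℝ} (hab : a ≤ b)
    (h : ∀ x ∈ Set.Ioc a b, x ^ 2 ≤ c) :
    (b - a) * ((√(2 * π))⁻¹ * exp (-c / 2)) ≤ (gaussianReal 0 1).real (Set.Ioc a b) := by
  rw [measureReal_def, gaussianReal_apply_eq_integral 0 one_ne_zero,
    ENNReal.toReal_ofReal
      (setIntegral_nonneg measurableSet_Ioc fun x _ => gaussianPDFReal_nonneg 0 1 x)]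
  have hconst : ∫ _ in Set.Ioc a b, (√(2 * π))⁻¹ * exp (-c / 2) =
      (b - a) * ((√(2 * π))⁻¹ * exp (-c / 2)) := by
    rw [setIntegral_const, Real.volume_real_Ioc_of_le hab, smul_eq_mul]
  rw [← hconst]
  refine setIntegral_mono_on (integrableOn_const measure_Ioc_lt_top.ne)
    (integrable_gaussianPDFReal 0 1).integrableOn measurableSet_Ioc fun x hx => ?_
  simp only [gaussianPDFReal, NNReal.coe_one, mul_one, sub_zero]
  gcongr
  exact h x hx

lemma gaussianReal_real_Iic_zero : (gaussianReal 0 1).real (Set.Iic 0) = 1 / 2 := by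
  have : NullSingletonClass (gaussianReal 0 1) := nullSingletonClass_gaussianReal one_ne_zero
  have hsymm : (gaussianReal 0 1).real (Set.Ioi 0) = (gaussianReal 0 1).real (Set.Iic 0) := by
    have hmap : (gaussianReal 0 1).map (fun x : ℝ => -x) = gaussianReal 0 1 := by
      rw [gaussianReal_map_neg, neg_zero]
    have hIio : (gaussianReal 0 1).real (Set.Iio 0) = (gaussianReal 0 1).real (Set.Iic 0) :=
      measureReal_congr Iio_ae_eq_Iic
    rw [← hIio]
    conv_rhs => rw [← hmap, map_measureReal_apply measurable_neg measurableSet_Iio]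
    congr 1
    ext x
    simp
  have hcompl := probReal_compl_eq_one_sub (μ := gaussianReal 0 1) (measurableSet_Iic (a := (0 : ℝ)))
  rw [Set.compl_Iic, hsymm] at hcompl
  linarith

instance : IsProbabilityMeasure stdGauss2 := by
  unfold stdGauss2
  infer_instance

lemma measurable_plugin (τ θ : ℝ) :
    Measurable fun p : ℝ × ℝ => (θ + p.1) ^ 2 / τ ^ 2 + p.2 := by
  fun_prop

instance (τ θ : ℝ) : IsProbabilityMeasure (pluginLaw τ θ) :=
  Measure.isProbabilityMeasure_map (measurable_plugin τ θ).aemeasurable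

lemma abs_measureReal_sub_le_one (μ ν : Measure ℝ) [IsProbabilityMeasure μ]
    [IsProbabilityMeasure ν] (A : Set ℝ) : |(μ A).toReal - (ν A).toReal| ≤ 1 := by
  have hμ : (μ A).toReal ≤ 1 := measureReal_le_one
  have hν : (ν A).toReal ≤ 1 := measureReal_le_one
  have hμ' : 0 ≤ (μ A).toReal := ENNReal.toReal_nonneg
  have hν' : 0 ≤ (ν A).toReal := ENNReal.toReal_nonneg
  rw [abs_le]
  constructor <;> linarith

lemma tvDist_le_one (μ ν : Measure ℝ) [IsProbabilityMeasure μ] [IsProbabilityMeasure ν] :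
    tvDist μ ν ≤ 1 :=
  Real.iSup_le (fun A => abs_measureReal_sub_le_one μ ν A.1) zero_le_one

lemma le_tvDist (μ ν : Measure ℝ) [IsProbabilityMeasure μ] [IsProbabilityMeasure ν]
    {A : Set ℝ} (hA : MeasurableSet A) : |(μ A).toReal - (ν A).toReal| ≤ tvDist μ ν :=
  le_ciSup (f := fun A : {A : Set ℝ // MeasurableSet A} => |(μ A.1).toReal - (ν A.1).toReal|)
    ⟨1, by rintro _ ⟨B, rfl⟩; exact abs_measureReal_sub_le_one μ ν B.1⟩ ⟨A, hA⟩

lemma plugin_zero_gap (τ : ℝ) (hτ : 0 < τ) :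
    ((√2 - 1) * exp (-(3/2)) / (2 * π)) * min 1 (1/τ^2)
      ≤ 1/2 - (stdGauss2 {p : ℝ × ℝ | p.1^2/τ^2 + p.2 ≤ 0}).toReal := by
  set m : ℝ := min 1 (1/τ^2) with hm
  have hm0 : 0 ≤ m := le_min zero_le_one (by positivity)
  have hm1 : m ≤ 1 := min_le_left _ _
  set S : Set (ℝ × ℝ) := {p | p.1^2/τ^2 + p.2 ≤ 0}
  set R : Set (ℝ × ℝ) := Set.Ioc 1 √2 ×ˢ Set.Ioc (-m) 0
  have hdisj : Disjoint S R := by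
    rw [Set.disjoint_left]
    rintro ⟨z, g⟩ hS ⟨hz, hg⟩
    have hS' : z^2/τ^2 + g ≤ 0 := hS
    have h1 : 1/τ^2 ≤ z^2/τ^2 := by
      gcongr
      nlinarith [hz.1]
    have h2 : m ≤ 1/τ^2 := min_le_right _ _
    have h3 : -m < g := hg.1
    linarith
  have hsub : S ∪ R ⊆ Set.univ ×ˢ Set.Iic 0 := by
    rintro ⟨z, g⟩ (hS | hR)
    · have hS' : z^2/τ^2 + g ≤ 0 := hS
      have : 0 ≤ z^2/τ^2 := by positivity
      exact ⟨trivial, show g ≤ 0 by linarith⟩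
    · exact ⟨trivial, hR.2.2⟩
  have hle : stdGauss2.real S + stdGauss2.real R ≤ 1/2 := by
    rw [← measureReal_union hdisj (measurableSet_Ioc.prod measurableSet_Ioc)]
    refine (measureReal_mono hsub).trans_eq ?_
    rw [stdGauss2, measureReal_prod_prod, gaussianReal_real_Iic_zero]
    simp
  have hR : (√2 - 1) * exp (-(3/2)) / (2 * π) * m ≤ stdGauss2.real R := by
    have hZ := gaussianReal_real_Ioc_ge (a := 1) (b := √2) (c := 2)
      (Real.one_le_sqrt.mpr one_le_two) fun x hx => by
        have := Real.sq_sqrt (zero_le_two (α := ℝ))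
        nlinarith [hx.1, hx.2]
    have hG := gaussianReal_real_Ioc_ge (a := -m) (b := 0) (c := 1) (by linarith) fun x hx => by
        nlinarith [hx.1, hx.2]
    rw [stdGauss2, measureReal_prod_prod]
    refine le_trans (le_of_eq ?_) (mul_le_mul hZ hG (by rw [sub_neg_eq_add]; positivity)
      measureReal_nonneg)
    have hexp : exp (-(3/2)) = exp (-2/2) * exp (-1/2) := by
      rw [← Real.exp_add]
      norm_num
    have hpi : (2 * π)⁻¹ = (√(2 * π))⁻¹ * (√(2 * π))⁻¹ := by
      rw [← mul_inv, Real.mul_self_sqrt (by positivity)]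
    rw [hexp, div_eq_mul_inv, hpi]
    ring
  have hS : (stdGauss2 S).toReal = stdGauss2.real S := rfl
  linarith

/-- inefficiency of the plug-in approach for the square link.
The worst-case TV distance between the plug-in law and `N(θ²/τ², 1)` over
`θ ∈ [−1,1]` is at least `((√2 − 1)·e^{−3/2}/(2π))·min(1, 1/τ²)`; in
particular, already at `θ = 0`,
`1/2 − P(Z²/τ² + G ≤ 0) ≥ ((√2 − 1)·e^{−3/2}/(2π))·min(1, 1/τ²)`. -/
theorem plugin_lower_bound (τ : ℝ) (hτ : 0 < τ) :
    ((Real.sqrt 2 - 1) * Real.exp (-(3/2)) / (2 * Real.pi)) * min 1 (1/τ^2)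
        ≤ ⨆ θ : Set.Icc (-1:ℝ) 1,
            tvDist (pluginLaw τ (θ:ℝ)) (gaussianReal ((θ:ℝ)^2/τ^2) 1) ∧
    ((Real.sqrt 2 - 1) * Real.exp (-(3/2)) / (2 * Real.pi)) * min 1 (1/τ^2)
        ≤ 1/2 - (stdGauss2 {p : ℝ × ℝ | p.1^2/τ^2 + p.2 ≤ 0}).toReal := by
  refine ⟨?_, plugin_zero_gap τ hτ⟩
  have hlaw : pluginLaw τ 0 (Set.Iic 0) = stdGauss2 {p : ℝ × ℝ | p.1^2/τ^2 + p.2 ≤ 0} := by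
    rw [pluginLaw, Measure.map_apply (measurable_plugin τ 0) measurableSet_Iic]
    simp [Set.preimage]
  have htv := le_tvDist (pluginLaw τ 0) (gaussianReal 0 1) (measurableSet_Iic (a := (0 : ℝ)))
  have hhalf : (gaussianReal 0 1 (Set.Iic 0)).toReal = 1 / 2 := gaussianReal_real_Iic_zero
  rw [hlaw, hhalf, abs_sub_comm] at htv
  have hsup := le_ciSup (f := fun θ : Set.Icc (-1:ℝ) 1 =>
      tvDist (pluginLaw τ (θ:ℝ)) (gaussianReal ((θ:ℝ)^2/τ^2) 1))
    ⟨1, by rintro _ ⟨θ, rfl⟩; exact tvDist_le_one _ _⟩ ⟨0, by norm_num⟩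
  have hzero : (0:ℝ)^2/τ^2 = 0 := by simp
  simp only [hzero] at hsup
  exact (plugin_zero_gap τ hτ).trans ((le_abs_self _).trans (htv.trans hsup))
end
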